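/- Assume p < n/s. Let μ ∈ C_0^∞(ℝⁿ) be nonnegative, g ∈ W^{s,p}(ℝⁿ), and let u ∈ W^{s,p}(ℝⁿ) be a weak solution of −L_Φ u = μ in Ω with u = g on ℝⁿ∖Ω, such that u ≥ 0 a.e. in a ball B_{4r}(x₀) ⊂ Ω. Let h ∈ (0,s) and q ∈ (0, q̄), where q̄ := min{n(p−1)/(n−s), p}. Then ( ∫_{B_{2r}(x₀)} ⨍_{B_{2r}(x₀)} |u(x)−u(y)|^q |x−y|^{−n−hq} dx dy )^{1/q} ≤ c r^{−h} [ inf_{B_r(x₀)} u + Tail(u₋; x₀, 4r) ], where u₋ := max{−u, 0}, the infimum is the essential infimum, and c depends only on n, s, p, Λ, s−h, q̄−q. -/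

import Mathlib

noncomputable section

open MeasureTheory Metric Set Filter Topology
open scoped ENNReal NNReal

/-- Euclidean space `ℝⁿ`. -/
abbrev Rn (n : ℕ) : Type := EuclideanSpace ℝ (Fin n)

/-- `q_* = max {1, p-1}`. -/
def qStar (p : ℝ) : ℝ := max 1 (p - 1)

/-- `q̄ = min {n(p-1)/(n-s), p}`. -/
def qBar (n : ℕ) (s p : ℝ) : ℝ := min ((n : ℝ) * (p - 1) / ((n : ℝ) - s)) p

/-- Gagliardo seminorm raised to the power `p`, as an `ℝ≥0∞`-valued double integral. -/
def gagliardo (n : ℕ) (s p : ℝ) (O : Set (Rn n)) (v : Rn n → ℝ) : ℝ≥0∞ :=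
  ∫⁻ x in O, ∫⁻ y in O, ENNReal.ofReal (|v x - v y| ^ p / ‖x - y‖ ^ ((n : ℝ) + s * p))

/-- `v ∈ W^{s,p}(O)`. -/
def memWsp (n : ℕ) (s p : ℝ) (O : Set (Rn n)) (v : Rn n → ℝ) : Prop :=
  AEMeasurable v (volume.restrict O) ∧
    (∫⁻ x in O, ENNReal.ofReal (|v x| ^ p)) < ⊤ ∧ gagliardo n s p O v < ⊤

/-- `Tail(v; x₀, r)`. -/
def tailFn (n : ℕ) (s p : ℝ) (v : Rn n → ℝ) (x₀ : Rn n) (r : ℝ) : ℝ≥0∞ :=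
  (ENNReal.ofReal (r ^ (s * p)) *
      ∫⁻ x in (ball x₀ r)ᶜ,
        ENNReal.ofReal (|v x| ^ (p - 1) / ‖x - x₀‖ ^ ((n : ℝ) + s * p))) ^ (1 / (p - 1))

/-- `v ∈ L^{p-1}_{sp}(ℝⁿ)`. -/
def memTailSpace (n : ℕ) (s p : ℝ) (v : Rn n → ℝ) : Prop :=
  AEMeasurable v (volume : Measure (Rn n)) ∧
    (∀ R : ℝ, (∫⁻ x in ball (0 : Rn n) R, ENNReal.ofReal (|v x| ^ (p - 1))) < ⊤) ∧
    ∀ z : Rn n, ∀ r : ℝ, 0 < r → tailFn n s p v z r < ⊤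

/-- `φ ∈ C_0^∞(O)`. -/
def IsTestFun (n : ℕ) (O : Set (Rn n)) (φ : Rn n → ℝ) : Prop :=
  ContDiff ℝ (⊤ : ℕ∞) φ ∧ HasCompactSupport φ ∧ tsupport φ ⊆ O

/-- The nonlocal form `⟨-L_Φ u, φ⟩`. -/
def nonlocalForm (n : ℕ) (Φ : ℝ → ℝ) (K : Rn n → Rn n → ℝ) (u φ : Rn n → ℝ) : ℝ :=
  ∫ x : Rn n, ∫ y : Rn n, Φ (u x - u y) * (φ x - φ y) * K x y

/-- Ellipticity/coercivity bounds on the kernel `K`. -/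
def KernelBounds (n : ℕ) (Λ s p : ℝ) (K : Rn n → Rn n → ℝ) : Prop :=
  Measurable (Function.uncurry K) ∧
    ∀ x y : Rn n, x ≠ y →
      1 / (Λ * ‖x - y‖ ^ ((n : ℝ) + s * p)) ≤ K x y ∧
        K x y ≤ Λ / ‖x - y‖ ^ ((n : ℝ) + s * p)

/-- Structure conditions on `Φ`. -/
def PhiBounds (Λ p : ℝ) (Φ : ℝ → ℝ) : Prop :=
  Continuous Φ ∧ Φ 0 = 0 ∧
    ∀ t : ℝ, |t| ^ p / Λ ≤ Φ t * t ∧ Φ t * t ≤ Λ * |t| ^ p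

/-- `∫ φ dμ` for a signed measure `μ`. -/
def sintegral (n : ℕ) (μ : MeasureTheory.SignedMeasure (Rn n)) (φ : Rn n → ℝ) : ℝ :=
  (∫ x, φ x ∂μ.toJordanDecomposition.posPart) -
    ∫ x, φ x ∂μ.toJordanDecomposition.negPart

/-- Weak (energy) solution of `-L_Φ u = f` in `Ω`, `u = g` on `ℝⁿ ∖ Ω`. -/
def WeakSol (n : ℕ) (Φ : ℝ → ℝ) (K : Rn n → Rn n → ℝ) (s p : ℝ)
    (Ω : Set (Rn n)) (f g u : Rn n → ℝ) : Prop :=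
  memWsp n s p univ u ∧ (∀ᵐ x : Rn n, x ∉ Ω → u x = g x) ∧
    ∀ φ : Rn n → ℝ, IsTestFun n Ω φ → nonlocalForm n Φ K u φ = ∫ x : Rn n, φ x * f x

/-- Weak subsolution of the homogeneous equation `-L_Φ w = 0` in `Ω`. -/
def WeakSubSol (n : ℕ) (Φ : ℝ → ℝ) (K : Rn n → Rn n → ℝ) (s p : ℝ)
    (Ω : Set (Rn n)) (w : Rn n → ℝ) : Prop :=
  memWsp n s p univ w ∧
    ∀ φ : Rn n → ℝ, IsTestFun n Ω φ → (∀ x, 0 ≤ φ x) → nonlocalForm n Φ K w φ ≤ 0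

/-- The approximation properties required of a SOLA. -/
def SOLAApprox (n : ℕ) (Φ : ℝ → ℝ) (K : Rn n → Rn n → ℝ) (s p : ℝ)
    (Ω : Set (Rn n)) (μ : MeasureTheory.SignedMeasure (Rn n)) (g u : Rn n → ℝ)
    (uj μj gj : ℕ → Rn n → ℝ) : Prop :=
  (∀ j, ContDiff ℝ (⊤ : ℕ∞) (μj j) ∧ HasCompactSupport (μj j)) ∧
  (∀ j, ContDiff ℝ (⊤ : ℕ∞) (gj j) ∧ HasCompactSupport (gj j)) ∧
  (∀ j, WeakSol n Φ K s p Ω (μj j) (gj j) (uj j)) ∧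
  (∀ᵐ x : Rn n, Tendsto (fun j => uj j x) atTop (𝓝 (u x))) ∧
  (∀ q : ℝ, qStar p ≤ q → q < qBar n s p → ∀ z : Rn n, ∀ r : ℝ, 0 < r →
    Tendsto (fun j => ∫⁻ x in ball z r, ENNReal.ofReal (|uj j x - u x| ^ q)) atTop (𝓝 0)) ∧
  (∀ φ : Rn n → ℝ, Continuous φ → HasCompactSupport φ → tsupport φ ⊆ Ω →
    Tendsto (fun j => ∫ x : Rn n, φ x * μj j x) atTop (𝓝 (sintegral n μ φ))) ∧
  (∀ z : Rn n, ∀ r : ℝ, 0 < r →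
    Filter.limsup (fun j => ∫⁻ x in ball z r, ENNReal.ofReal |μj j x|) atTop
      ≤ μ.totalVariation (closedBall z r)) ∧
  (∀ z : Rn n, ∀ r : ℝ, 0 < r →
    Tendsto (fun j =>
        (∫⁻ x in ball z r, ENNReal.ofReal (|gj j x - g x| ^ p)) +
          gagliardo n s p (ball z r) (fun x => gj j x - g x)) atTop (𝓝 0) ∧
      Tendsto (fun j => tailFn n s p (fun x => gj j x - g x) z r) atTop (𝓝 0))

/-- SOLA of the Dirichlet problem `-L_Φ u = μ` in `Ω`, `u = g` on `ℝⁿ ∖ Ω`. -/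
def IsSOLA (n : ℕ) (Φ : ℝ → ℝ) (K : Rn n → Rn n → ℝ) (s p : ℝ)
    (Ω : Set (Rn n)) (μ : MeasureTheory.SignedMeasure (Rn n)) (g u : Rn n → ℝ) : Prop :=
  (∀ h q : ℝ, 0 < h → h < s → qStar p ≤ q → q < qBar n s p → memWsp n h q Ω u) ∧
  (∀ φ : Rn n → ℝ, IsTestFun n Ω φ → nonlocalForm n Φ K u φ = sintegral n μ φ) ∧
  (∀ᵐ x : Rn n, x ∉ Ω → u x = g x) ∧
  ∃ uj μj gj : ℕ → Rn n → ℝ, SOLAApprox n Φ K s p Ω μ g u uj μj gj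

/-- Truncated Wolff potential `W^ν_{s,p}(x₀, r)`. -/
def wolff (n : ℕ) (s p : ℝ) (ν : Measure (Rn n)) (x₀ : Rn n) (r : ℝ) : ℝ≥0∞ :=
  ∫⁻ ρ in Ioc (0 : ℝ) r,
    (ν (ball x₀ ρ) / ENNReal.ofReal (ρ ^ ((n : ℝ) - s * p))) ^ (1 / (p - 1)) /
      ENNReal.ofReal ρ

/-- Integral average of `u` over `B_r(x₀)`. -/
def ballAvg (n : ℕ) (u : Rn n → ℝ) (x₀ : Rn n) (r : ℝ) : ℝ :=
  ⨍ x in ball x₀ r, u x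

/-- Local excess `A(f; x₀, r)`. -/
def locExcess (n : ℕ) (p : ℝ) (f : Rn n → ℝ) (x₀ : Rn n) (r : ℝ) : ℝ≥0∞ :=
  ((volume (ball x₀ r))⁻¹ *
      ∫⁻ x in ball x₀ r, ENNReal.ofReal (|f x - ballAvg n f x₀ r| ^ qStar p)) ^ (1 / qStar p)

/-- Global excess `E(f; x₀, r)`. -/
def excess (n : ℕ) (s p : ℝ) (f : Rn n → ℝ) (x₀ : Rn n) (r : ℝ) : ℝ≥0∞ :=
  locExcess n p f x₀ r + tailFn n s p (fun x => f x - ballAvg n f x₀ r) x₀ r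

/-- `g ∈ W^{s,p}_loc(ℝⁿ) ∩ L^{p-1}_{sp}(ℝⁿ)`. -/
def BoundaryDatum (n : ℕ) (s p : ℝ) (g : Rn n → ℝ) : Prop :=
  (∀ z : Rn n, ∀ r : ℝ, 0 < r → memWsp n s p (ball z r) g) ∧ memTailSpace n s p g

/-- Symmetric measurable kernel with ellipticity bounds. -/
def SymKernel (n : ℕ) (Λ s p : ℝ) (Kt : Rn n → Rn n → ℝ) : Prop :=
  KernelBounds n Λ s p Kt ∧ ∀ x y : Rn n, Kt x y = Kt y x

/-- Weak solution of the kernel-`Kt` fractional `p`-Laplace equation with datum `f` in `O`. -/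
def WeakSolP (n : ℕ) (Kt : Rn n → Rn n → ℝ) (s p : ℝ) (O : Set (Rn n))
    (f u : Rn n → ℝ) : Prop :=
  memWsp n s p univ u ∧
    ∀ φ : Rn n → ℝ, IsTestFun n O φ →
      (∫ x : Rn n, ∫ y : Rn n,
          |u x - u y| ^ (p - 2) * (u x - u y) * (φ x - φ y) * Kt x y) =
        ∫ x : Rn n, φ x * f x

/-- Powers of the norm larger than the critical one are integrable on balls. -/
theorem lintegral_ball_rpow_norm_lt_top {n : ℕ} (hn : 0 < n) {α : ℝ} (hα : -(n : ℝ) < α) (R : ℝ) :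
    ∫⁻ z in ball (0 : Rn n) R, ENNReal.ofReal (‖z‖ ^ α) < ⊤ := by
  have h : IntegrableOn (fun z : Rn n => ‖z‖ ^ α) (ball 0 R) := by
    refine integrableOn_ball_of_norm_le_rpow (C := 1) (α := -α)
      (by simpa using Nat.one_le_iff_ne_zero.2 hn.ne')
      (by simp; linarith) ?_ ?_
    · refine Eventually.of_forall fun x => ?_
      simp [abs_of_nonneg (Real.rpow_nonneg (norm_nonneg x) α)]
    · exact (measurable_norm.pow_const α).aestronglyMeasurable
  exact (hasFiniteIntegral_iff_ofReal (Eventually.of_forall fun z =>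
    Real.rpow_nonneg (norm_nonneg z) α)).1 h.2

/-- Powers of the norm smaller than the critical one are integrable away from the origin. -/
theorem lintegral_compl_ball_rpow_norm_lt_top {n : ℕ} {α : ℝ} (hα : α < -(n : ℝ)) :
    ∫⁻ z in (ball (0 : Rn n) 1)ᶜ, ENNReal.ofReal (‖z‖ ^ α) < ⊤ := by
  have h : Integrable (fun z : Rn n => 2 ^ (-α) * (1 + ‖z‖) ^ (-(-α))) :=
    (integrable_one_add_norm (by simp; linarith)).const_mul _
  have h' := (hasFiniteIntegral_iff_ofReal (Eventually.of_forall fun z => by positivity)).1 h.2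
  refine lt_of_le_of_lt ?_ h'
  refine (setLIntegral_mono' measurableSet_ball.compl fun z hz => ?_).trans
    (setLIntegral_le_lintegral _ _)
  have hz1 : 1 ≤ ‖z‖ := by simpa using hz
  have hn0 : (0 : ℝ) ≤ n := Nat.cast_nonneg n
  apply ENNReal.ofReal_le_ofReal
  rw [neg_neg, Real.rpow_neg (by norm_num), ← Real.inv_rpow (by norm_num),
    ← Real.mul_rpow (by norm_num) (by positivity)]
  exact Real.rpow_le_rpow_of_nonpos (by positivity) (by linarith) (by linarith)

/-- The kernel of the fractional `p`-Laplacian integrates the `p`-th power of a bounded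
Lipschitz function. -/
theorem lintegral_min_rpow_mul_kernel_lt_top {n : ℕ} {s p : ℝ} (hn : 0 < n) (hs : 0 < s)
    (hs1 : s < 1) (hp : 1 < p) :
    ∫⁻ z : Rn n, ENNReal.ofReal ((min 1 ‖z‖) ^ p * ‖z‖ ^ (-((n : ℝ) + s * p))) < ⊤ := by
  rw [← lintegral_add_compl _ (measurableSet_ball (x := (0 : Rn n)) (ε := 1))]
  refine ENNReal.add_lt_top.2 ⟨?_, ?_⟩
  · refine lt_of_le_of_lt (setLIntegral_mono' measurableSet_ball fun z hz => ?_)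
      (lintegral_ball_rpow_norm_lt_top hn (α := p - ((n : ℝ) + s * p)) (by nlinarith) 1)
    apply ENNReal.ofReal_le_ofReal
    rcases (norm_nonneg z).eq_or_lt with h | h
    · rw [← h, min_eq_right (by norm_num), Real.zero_rpow (by linarith), zero_mul]
      positivity
    · rw [sub_eq_add_neg, Real.rpow_add h]
      gcongr
      exact min_le_right _ _
  · refine lt_of_le_of_lt (setLIntegral_mono' measurableSet_ball.compl fun z hz => ?_)
      (lintegral_compl_ball_rpow_norm_lt_top (α := -((n : ℝ) + s * p)) (by nlinarith))
    apply ENNReal.ofReal_le_ofReal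
    have : (min 1 ‖z‖) ^ p ≤ 1 :=
      Real.rpow_le_one (le_min zero_le_one (norm_nonneg z)) (min_le_left _ _) (by linarith)
    exact mul_le_of_le_one_left (by positivity) this

/-- A fast geometric decay lemma: a sequence of measures of level sets whose successive terms are
controlled through the kernel on balls of any small radius tends to zero, provided its first term
is small. -/
theorem exists_small_forall_tendsto_zero {n : ℕ} {s p D ω : ℝ} (hn : 0 < n) (hs : 0 < s)
    (hs1 : s < 1) (hp : 1 < p) (hD : 0 ≤ D) (hω : 0 < ω) :
    ∃ ε : ℝ, 0 < ε ∧ ∀ a : ℕ → ℝ, (∀ k, 0 ≤ a k) →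
      (∀ k ρ, 0 < ρ → ρ ≤ (1 / 2 : ℝ) ^ (k + 4) →
        a (k + 1) * (((1 / 2 : ℝ) ^ (k + 3)) ^ p * ρ ^ (-((n : ℝ) + s * p)) *
          (ω * ρ ^ n - a k)) ≤ D * a k) →
      a 0 ≤ ε → Tendsto a atTop (𝓝 0) := by
  have hsp : 0 < s * p := by positivity
  set β : ℝ := (1 / 2 : ℝ) ^ (1 / s) with hβ
  have hβ0 : 0 < β := by positivity
  have hβ2 : β ≤ 1 / 2 := by
    have := Real.rpow_le_rpow_of_exponent_ge (x := (1 / 2 : ℝ)) (y := 1 / s) (z := 1)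
      (by norm_num) (by norm_num) (by rw [le_div_iff₀ hs]; linarith)
    rwa [Real.rpow_one] at this
  have hβs : β ^ (s * p) = (1 / 2 : ℝ) ^ p := by
    rw [hβ, ← Real.rpow_mul (by norm_num)]
    congr 1; field_simp
  obtain ⟨ρ₀, hρ₀, hρ₀1, hρ₀2⟩ : ∃ ρ₀ : ℝ, 0 < ρ₀ ∧ ρ₀ ≤ 1 / 16 ∧
      D * 8 ^ p * ρ₀ ^ (s * p) < 1 / 2 * ω * β ^ n := by
    have h1 : Tendsto (fun ρ : ℝ => D * 8 ^ p * ρ ^ (s * p)) (𝓝[>] 0) (𝓝 (D * 8 ^ p * 0)) := by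
      refine Tendsto.const_mul _ ?_
      have := (Real.continuousAt_rpow_const 0 (s * p) (Or.inr hsp.le)).tendsto
      rw [Real.zero_rpow hsp.ne'] at this
      exact this.mono_left nhdsWithin_le_nhds
    rw [mul_zero] at h1
    have h2 := h1.eventually (gt_mem_nhds (show 0 < 1 / 2 * ω * β ^ n by positivity))
    have h3 : ∀ᶠ ρ : ℝ in 𝓝[>] 0, ρ ≤ 1 / 16 :=
      nhdsWithin_le_nhds (Iic_mem_nhds (by norm_num))
    obtain ⟨ρ, ⟨h4, h5⟩, h6⟩ := ((h2.and h3).and self_mem_nhdsWithin).exists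
    exact ⟨ρ, h6, h5, h4⟩
  refine ⟨1 / 2 * ω * ρ₀ ^ n, by positivity, fun a ha hrec h0 => ?_⟩
  have key : ∀ k, a k ≤ 1 / 2 * ω * (ρ₀ * β ^ k) ^ n := by
    intro k
    induction k with
    | zero => simpa using h0
    | succ k ih =>
      set ρ := ρ₀ * β ^ k with hρ
      have hρ0 : 0 < ρ := by positivity
      have hρle : ρ ≤ (1 / 2 : ℝ) ^ (k + 4) := by
        calc ρ ≤ 1 / 16 * (1 / 2 : ℝ) ^ k := by rw [hρ]; gcongr
          _ = _ := by rw [pow_add]; norm_num; ring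
      have h1 := hrec k ρ hρ0 hρle
      have hX : 0 < ((1 / 2 : ℝ) ^ (k + 3)) ^ p := by positivity
      have hY : ρ ^ (-((n : ℝ) + s * p)) * ρ ^ n * ρ ^ (s * p) = 1 := by
        rw [← Real.rpow_natCast ρ n, ← Real.rpow_add hρ0, ← Real.rpow_add hρ0]
        simp
      set Y := ρ ^ (-((n : ℝ) + s * p))
      have hY0 : 0 < Y := by positivity
      have hZ : 0 < ρ ^ (s * p) := by positivity
      have hN : 0 < ρ ^ n := by positivity
      have h2 : a (k + 1) * (((1 / 2 : ℝ) ^ (k + 3)) ^ p * Y * (1 / 2 * ω * ρ ^ n)) ≤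
          D * (1 / 2 * ω * ρ ^ n) := by
        refine le_trans ?_ (h1.trans (by gcongr))
        gcongr
        · exact ha _
        · linarith
      have h3 : a (k + 1) * (((1 / 2 : ℝ) ^ (k + 3)) ^ p * Y) ≤ D := by
        have h4 : 0 < 1 / 2 * ω * ρ ^ n := by positivity
        refine le_of_mul_le_mul_right ?_ h4
        linarith
      have h5 : ρ ^ (s * p) = ρ₀ ^ (s * p) * ((1 / 2 : ℝ) ^ k) ^ p := by
        have h51 : (β ^ k) ^ (s * p) = ((1 / 2 : ℝ) ^ k) ^ p := by
          rw [← Real.rpow_pow_comm hβ0.le, hβs, Real.rpow_pow_comm (by norm_num)]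
        rw [hρ, Real.mul_rpow hρ₀.le (by positivity), h51]
      have h6 : ((1 / 2 : ℝ) ^ (k + 3)) ^ p * 8 ^ p = ((1 / 2 : ℝ) ^ k) ^ p := by
        rw [← Real.mul_rpow (by positivity) (by norm_num)]
        congr 1; rw [pow_add]; ring
      have h7 : (ρ₀ * β ^ (k + 1)) ^ n = ρ ^ n * β ^ n := by
        rw [hρ, ← mul_pow]; ring
      rw [h7]
      have h8 : a (k + 1) * ((1 / 2 : ℝ) ^ (k + 3)) ^ p ≤ D * (ρ ^ n * ρ ^ (s * p)) := by
        have := mul_le_mul_of_nonneg_right h3 (mul_pos hN hZ).le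
        calc _ = a (k + 1) * ((1 / 2 : ℝ) ^ (k + 3)) ^ p * (Y * ρ ^ n * ρ ^ (s * p)) := by
              rw [hY]; ring
          _ = a (k + 1) * (((1 / 2 : ℝ) ^ (k + 3)) ^ p * Y) * (ρ ^ n * ρ ^ (s * p)) := by ring
          _ ≤ _ := this
      refine le_of_mul_le_mul_right (h8.trans ?_) hX
      calc D * (ρ ^ n * ρ ^ (s * p)) = ρ ^ n * ((1 / 2 : ℝ) ^ (k + 3)) ^ p *
            (D * 8 ^ p * ρ₀ ^ (s * p)) := by rw [h5, ← h6]; ring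
        _ ≤ ρ ^ n * ((1 / 2 : ℝ) ^ (k + 3)) ^ p * (1 / 2 * ω * β ^ n) := by gcongr
        _ = _ := by ring
  refine squeeze_zero ha key ?_
  have h1 : Tendsto (fun k : ℕ => β ^ k) atTop (𝓝 0) :=
    tendsto_pow_atTop_nhds_zero_of_lt_one hβ0.le (by linarith)
  have h2 := (((h1.const_mul ρ₀).pow n).const_mul (1 / 2 * ω))
  rwa [mul_zero, zero_pow hn.ne', mul_zero] at h2

/-- The nonlocal flux of `φ` along the increments of `u`: only pairs with `u x < u y` and
`φ y < φ x` contribute. -/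
def upFlux (n : ℕ) (s p : ℝ) (u φ : Rn n → ℝ) : ℝ≥0∞ :=
  ∫⁻ x : Rn n, ∫⁻ y : Rn n, ENNReal.ofReal
    (max (u y - u x) 0 ^ (p - 1) * max (φ x - φ y) 0 * ‖x - y‖ ^ (-((n : ℝ) + s * p)))

/-- The tail of the negative part outside `B_4`. -/
def negTail (n : ℕ) (s p : ℝ) (u : Rn n → ℝ) : ℝ≥0∞ :=
  ∫⁻ x in (ball (0 : Rn n) 4)ᶜ, ENNReal.ofReal
    (max (-u x) 0 ^ (p - 1) * ‖x‖ ^ (-((n : ℝ) + s * p)))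

/-- The constant bounding downward fluxes. -/
def fluxConst (n : ℕ) (s p : ℝ) : ℝ≥0∞ :=
  (∫⁻ z : Rn n, ENNReal.ofReal ((min 1 ‖z‖) ^ p * ‖z‖ ^ (-((n : ℝ) + s * p)))) +
    ENNReal.ofReal (4 ^ ((n : ℝ) + s * p)) *
      ((∫⁻ z in (ball (0 : Rn n) 1)ᶜ, ENNReal.ofReal (‖z‖ ^ (-((n : ℝ) + s * p)))) + 1)

theorem fluxConst_ne_top {n : ℕ} {s p : ℝ} (hn : 0 < n) (hs : 0 < s) (hs1 : s < 1)
    (hp : 1 < p) : fluxConst n s p ≠ ⊤ := by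
  have h1 := lintegral_min_rpow_mul_kernel_lt_top hn hs hs1 hp
  have h2 := lintegral_compl_ball_rpow_norm_lt_top (n := n) (α := -((n : ℝ) + s * p))
    (by nlinarith)
  exact ENNReal.add_ne_top.2 ⟨h1.ne, ENNReal.mul_ne_top ENNReal.ofReal_ne_top
    (ENNReal.add_ne_top.2 ⟨h2.ne, ENNReal.one_ne_top⟩)⟩

/-- Pointwise control of the downward flux density gives control of the downward flux. -/
theorem upFlux_neg_le {n : ℕ} {s p : ℝ} (hs : 0 < s) (hp : 1 < p)
    {u φ b : Rn n → ℝ} (hu : Measurable u) (hb : Measurable b)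
    (hb0 : ∀ y, 0 ≤ b y) (htail : negTail n s p u ≤ 1)
    (h : ∀ x y, u x < u y → φ x < φ y →
      (u y - u x) ^ (p - 1) * (φ y - φ x) ≤ b y * (min 1 ‖x - y‖) ^ p ∨
      (4 ≤ ‖x‖ ∧ ‖y‖ ≤ 3 ∧
        (u y - u x) ^ (p - 1) * (φ y - φ x) ≤ b y * (1 + max (-u x) 0 ^ (p - 1)))) :
    upFlux n s p u (fun x => -φ x) ≤ fluxConst n s p * ∫⁻ y, ENNReal.ofReal (b y) := by
  set e := (n : ℝ) + s * p with he
  have he0 : 0 ≤ e := by positivity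
  set F : Rn n → Rn n → ℝ≥0∞ := fun x y =>
    ENNReal.ofReal (b y) * ENNReal.ofReal ((min 1 ‖x - y‖) ^ p * ‖x - y‖ ^ (-e)) +
    ENNReal.ofReal (b y) * (ENNReal.ofReal (4 ^ e) * (ball (0 : Rn n) 4)ᶜ.indicator
      (fun x => ENNReal.ofReal (‖x‖ ^ (-e)) +
        ENNReal.ofReal (max (-u x) 0 ^ (p - 1) * ‖x‖ ^ (-e))) x) with hF
  have hpt : ∀ x y, ENNReal.ofReal (max (u y - u x) 0 ^ (p - 1) * max (-φ x - -φ y) 0 *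
      ‖x - y‖ ^ (-e)) ≤ F x y := by
    intro x y
    by_cases hxy : u x < u y ∧ φ x < φ y
    · obtain ⟨h1, h2⟩ := hxy
      have hk : 0 ≤ ‖x - y‖ ^ (-e) := Real.rpow_nonneg (norm_nonneg _) _
      rw [max_eq_left (by linarith : 0 ≤ u y - u x), max_eq_left (by linarith),
        show -φ x - -φ y = φ y - φ x by ring]
      rcases h x y h1 h2 with h3 | ⟨h3, h4, h5⟩
      · refine le_trans ?_ le_self_add
        rw [← ENNReal.ofReal_mul (hb0 y), ← mul_assoc]
        exact ENNReal.ofReal_le_ofReal (mul_le_mul_of_nonneg_right h3 hk)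
      · refine le_trans ?_ le_add_self
        have hx : x ∈ (ball (0 : Rn n) 4)ᶜ := by simpa using h3
        rw [indicator_of_mem hx, ← ENNReal.ofReal_add (by positivity) (by positivity),
          ← ENNReal.ofReal_mul (by positivity), ← ENNReal.ofReal_mul (hb0 y)]
        apply ENNReal.ofReal_le_ofReal
        have h6 : ‖x‖ / 4 ≤ ‖x - y‖ := by
          have := norm_sub_norm_le x y
          linarith
        have h7 : ‖x - y‖ ^ (-e) ≤ 4 ^ e * ‖x‖ ^ (-e) := by
          calc ‖x - y‖ ^ (-e) ≤ (‖x‖ / 4) ^ (-e) :=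
                Real.rpow_le_rpow_of_nonpos (by linarith) h6 (by linarith)
            _ = _ := by
              rw [Real.div_rpow (norm_nonneg _) (by norm_num),
                Real.rpow_neg (by norm_num : (0:ℝ) ≤ 4) e,
                div_inv_eq_mul, mul_comm]
        calc _ ≤ b y * (1 + max (-u x) 0 ^ (p - 1)) * (4 ^ e * ‖x‖ ^ (-e)) := by
              refine mul_le_mul h5 h7 hk ?_
              have := hb0 y
              positivity
          _ = _ := by ring
    · have : max (u y - u x) 0 ^ (p - 1) * max (-φ x - -φ y) 0 * ‖x - y‖ ^ (-e) = 0 := by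
        rcases not_and_or.1 hxy with h1 | h1
        · rw [max_eq_right (by linarith), Real.zero_rpow (by linarith)]; simp
        · rw [max_eq_right (by linarith : -φ x - -φ y ≤ 0)]; simp
      rw [this]; simp
  have hm1 : Measurable fun z : Rn n => ENNReal.ofReal ((min 1 ‖z‖) ^ p * ‖z‖ ^ (-e)) := by
    fun_prop
  have hm3 : Measurable fun x : Rn n => ENNReal.ofReal (‖x‖ ^ (-e)) +
        ENNReal.ofReal (max (-u x) 0 ^ (p - 1) * ‖x‖ ^ (-e)) := by fun_prop
  have hm2 : Measurable fun x => ENNReal.ofReal (4 ^ e) * (ball (0 : Rn n) 4)ᶜ.indicator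
      (fun x => ENNReal.ofReal (‖x‖ ^ (-e)) +
        ENNReal.ofReal (max (-u x) 0 ^ (p - 1) * ‖x‖ ^ (-e))) x :=
    (hm3.indicator measurableSet_ball.compl).const_mul _
  have hmb : Measurable fun y => ENNReal.ofReal (b y) := by fun_prop
  have hFm : Measurable (Function.uncurry F) := by
    simp only [hF, Function.uncurry_def]
    refine Measurable.fun_add ?_ ?_
    · exact (hmb.comp measurable_snd).mul (hm1.comp (measurable_fst.sub measurable_snd))
    · exact (hmb.comp measurable_snd).mul (hm2.comp measurable_fst)
  calc upFlux n s p u (fun x => -φ x) ≤ ∫⁻ x, ∫⁻ y, F x y :=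
        lintegral_mono fun x => lintegral_mono fun y => hpt x y
    _ = ∫⁻ y, ∫⁻ x, F x y := lintegral_lintegral_swap hFm.aemeasurable
    _ ≤ ∫⁻ y, fluxConst n s p * ENNReal.ofReal (b y) := by
        refine lintegral_mono fun y => ?_
        have hm4 : Measurable fun x : Rn n =>
            ENNReal.ofReal ((min 1 ‖x - y‖) ^ p * ‖x - y‖ ^ (-e)) := by fun_prop
        simp only [hF]
        rw [lintegral_add_right _ (hm2.const_mul _), lintegral_const_mul _ hm2,
          lintegral_const_mul _ hm4,
          lintegral_const_mul _ (hm3.indicator measurableSet_ball.compl),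
          lintegral_indicator measurableSet_ball.compl,
          lintegral_add_left (by fun_prop),
          lintegral_sub_right_eq_self (fun z : Rn n =>
            ENNReal.ofReal ((min 1 ‖z‖) ^ p * ‖z‖ ^ (-e))) y, ← mul_add, mul_comm]
        refine mul_le_mul_left ?_ _
        unfold fluxConst
        refine add_le_add_right (mul_le_mul_right (add_le_add ?_ htail) _) _
        exact lintegral_mono_set (compl_subset_compl.2 (ball_subset_ball (by norm_num)))
    _ = _ := lintegral_const_mul _ hmb

/-- The energy inequality satisfied by supersolutions, for bounded test functions supported in
`B_3` that are Lipschitz with respect to the increments of `u` and of the position. -/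
def FluxIneq (n : ℕ) (s p : ℝ) (C : ℝ≥0∞) (u : Rn n → ℝ) : Prop :=
  ∀ φ : Rn n → ℝ, Measurable φ → (∀ x, 0 ≤ φ x) → (∃ B, ∀ x, φ x ≤ B) →
    (∀ x, 3 ≤ ‖x‖ → φ x = 0) → (∃ L, ∀ x y, |φ x - φ y| ≤ L * (|u x - u y| + ‖x - y‖)) →
    upFlux n s p u φ ≤ C * upFlux n s p u (fun x => -φ x)

/-- A Lipschitz cutoff function equal to `1` on `B_{a-1}` and to `0` outside `B_a`. -/
def cutoff {n : ℕ} (a : ℝ) (x : Rn n) : ℝ := min 1 (max 0 (a - ‖x‖))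

section cutoff
variable {n : ℕ} {a : ℝ} {x y : Rn n}

theorem cutoff_nonneg : 0 ≤ cutoff a x := le_min zero_le_one (le_max_left _ _)

theorem cutoff_le_one : cutoff a x ≤ 1 := min_le_left _ _

theorem cutoff_eq_one (h : ‖x‖ ≤ a - 1) : cutoff a x = 1 :=
  min_eq_left (le_max_of_le_right (by linarith))

theorem cutoff_eq_zero (h : a ≤ ‖x‖) : cutoff a x = 0 := by
  rw [cutoff, max_eq_left (by linarith)]; simp

theorem abs_cutoff_sub_le : |cutoff a x - cutoff a y| ≤ min 1 ‖x - y‖ := by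
  refine le_min ?_ ?_
  · rw [abs_le]
    constructor <;>
    linarith [cutoff_nonneg (a := a) (x := x), cutoff_nonneg (a := a) (x := y),
      cutoff_le_one (a := a) (x := x), cutoff_le_one (a := a) (x := y)]
  · refine (abs_min_sub_min_le_max _ _ _ _).trans ?_
    rw [sub_self, abs_zero, max_eq_right (abs_nonneg _)]
    refine (abs_max_sub_max_le_max _ _ _ _).trans ?_
    rw [sub_self, abs_zero, max_eq_right (abs_nonneg _), sub_sub_sub_cancel_left, abs_sub_comm]
    exact abs_norm_sub_norm_le x y

theorem measurable_cutoff : Measurable (cutoff a : Rn n → ℝ) := by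
  unfold cutoff; fun_prop

end cutoff

theorem Real.add_rpow_le_two_rpow_mul {a b q : ℝ} (ha : 0 ≤ a) (hb : 0 ≤ b) (hq : 0 ≤ q) :
    (a + b) ^ q ≤ 2 ^ q * (a ^ q + b ^ q) := by
  have h1 : a + b ≤ 2 * max a b := by
    linarith [le_max_left a b, le_max_right a b]
  calc (a + b) ^ q ≤ (2 * max a b) ^ q := by gcongr
    _ = 2 ^ q * (max a b) ^ q := Real.mul_rpow (by norm_num) (le_max_of_le_left ha)
    _ ≤ _ := by
      gcongr
      rcases max_choice a b with h | h <;> rw [h]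
      · linarith [Real.rpow_nonneg hb q]
      · linarith [Real.rpow_nonneg ha q]

/-- The barrier `2θ - u₊` used in the De Giorgi iteration. -/
def barrier {n : ℕ} (u : Rn n → ℝ) (x : Rn n) : ℝ := 2 * cutoff 2 x - max (u x) 0

theorem measurable_barrier {n : ℕ} {u : Rn n → ℝ} (hu : Measurable u) :
    Measurable (barrier u) :=
  (measurable_cutoff.const_mul 2).sub (hu.max measurable_const)

theorem norm_lt_two_of_barrier_pos {n : ℕ} {u : Rn n → ℝ} {x : Rn n} (h : 0 < barrier u x) :
    ‖x‖ < 2 := by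
  by_contra! h2
  rw [barrier, cutoff_eq_zero h2] at h
  linarith [le_max_right (u x) 0]

/-- Downward flux of the truncations of the barrier. -/
theorem upFlux_neg_barrier_le {n : ℕ} {s p : ℝ} (hs : 0 < s) (hp : 1 < p)
    {u : Rn n → ℝ} (hu : Measurable u) (hu4 : ∀ x, ‖x‖ < 4 → 0 ≤ u x)
    (htail : negTail n s p u ≤ 1) {τ : ℝ} (hτ : 0 ≤ τ) :
    upFlux n s p u (fun x => -max (barrier u x - τ) 0) ≤
      fluxConst n s p * (ENNReal.ofReal (2 * 4 ^ p) * volume {x | τ < barrier u x}) := by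
  have hS : MeasurableSet {x | τ < barrier u x} :=
    measurableSet_lt measurable_const (measurable_barrier hu)
  have hb : Measurable ({x | τ < barrier u x}.indicator fun _ => (2 * 4 ^ p : ℝ)) :=
    measurable_const.indicator hS
  refine (upFlux_neg_le (b := {x | τ < barrier u x}.indicator fun _ => (2 * 4 ^ p : ℝ))
    hs hp hu hb (fun y => indicator_nonneg (fun _ _ => by positivity) y) htail ?_).trans_eq ?_
  · intro x y hxy hφ
    have hy : τ < barrier u y := by
      by_contra! h
      rw [max_eq_right (by linarith : barrier u y - τ ≤ 0)] at hφ
      linarith [le_max_right (barrier u x - τ) 0]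
    have hy2 := norm_lt_two_of_barrier_pos (hτ.trans_lt hy)
    have hcy := cutoff_le_one (a := 2) (x := y)
    have huy : u y ≤ 2 := by
      rw [barrier] at hy
      linarith [le_max_left (u y) 0]
    rw [indicator_of_mem (by exact hy)]
    rw [max_eq_left (by linarith : 0 ≤ barrier u y - τ)] at hφ ⊢
    rcases le_or_gt 0 (u x) with hx | hx
    · left
      have hcc := abs_cutoff_sub_le (a := 2) (x := x) (y := y)
      set M := min 1 ‖x - y‖
      have hM : 0 ≤ M := le_min zero_le_one (norm_nonneg _)
      have h1 := le_max_left (barrier u x - τ) 0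
      have h2 : barrier u y - barrier u x = 2 * (cutoff 2 y - cutoff 2 x) - (u y - u x) := by
        rw [barrier, barrier, max_eq_left hx, max_eq_left (hx.trans hxy.le)]; ring
      have h3 := (abs_le.1 hcc).1
      calc _ ≤ (2 * M) ^ (p - 1) * (2 * M) := by
            refine mul_le_mul (Real.rpow_le_rpow (by linarith) (by linarith) (by linarith))
              (by linarith) (by linarith) (by positivity)
        _ = 2 ^ p * M ^ p := by
            rcases hM.eq_or_lt with h | h
            · rw [← h, Real.zero_rpow (by linarith : p ≠ 0)]; simp
            · rw [← Real.mul_rpow (by norm_num) hM, ← Real.rpow_add_one (by positivity)]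
              simp
        _ ≤ _ := by
            have : (2 : ℝ) ^ p ≤ 4 ^ p := by gcongr; norm_num
            have h4 : (0 : ℝ) < 4 ^ p := by positivity
            gcongr
            linarith
    · right
      refine ⟨?_, by linarith, ?_⟩
      · by_contra! h
        linarith [hu4 x h]
      · have h1 : 0 ≤ u y := hu4 y (by linarith)
        have h2 := le_max_right (barrier u x - τ) 0
        have h3 : barrier u y - τ - max (barrier u x - τ) 0 ≤ 2 := by
          have h0 : barrier u y ≤ 2 := by
            rw [barrier]
            linarith [le_max_right (u y) 0]
          linarith
        rw [max_eq_left (by linarith : 0 ≤ -u x)]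
        calc _ ≤ (2 + -u x) ^ (p - 1) * 2 := by
              refine mul_le_mul (Real.rpow_le_rpow (by linarith) (by linarith) (by linarith))
                h3 (by linarith) (Real.rpow_nonneg (by linarith) _)
          _ ≤ 2 ^ (p - 1) * (2 ^ (p - 1) + (-u x) ^ (p - 1)) * 2 := by
              gcongr
              exact Real.add_rpow_le_two_rpow_mul (by norm_num) (by linarith) (by linarith)
          _ ≤ 2 ^ p * (2 ^ p * 1 + 2 ^ p * (-u x) ^ (p - 1)) * 2 := by
              have h4 : (2 : ℝ) ^ (p - 1) ≤ 2 ^ p :=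
                Real.rpow_le_rpow_of_exponent_le (by norm_num) (by linarith)
              have h5 : (1 : ℝ) ≤ 2 ^ p := Real.one_le_rpow (by norm_num) (by linarith)
              have h6 : 0 ≤ (-u x) ^ (p - 1) := Real.rpow_nonneg (by linarith) _
              gcongr
              · linarith
              · exact le_mul_of_one_le_left h6 h5
          _ = _ := by
              rw [show (4 : ℝ) = 2 * 2 by norm_num, Real.mul_rpow (by norm_num) (by norm_num)]
              ring
  · congr 1
    rw [← lintegral_indicator_const hS]
    refine lintegral_congr fun x => ?_
    by_cases h : x ∈ {x | τ < barrier u x}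
    · rw [indicator_of_mem h, indicator_of_mem h]
    · rw [indicator_of_notMem h, indicator_of_notMem h, ENNReal.ofReal_zero]

/-- The energy inequality tested with truncations of the barrier. -/
theorem FluxIneq.barrier_le {n : ℕ} {s p : ℝ} {C : ℝ≥0∞} (hs : 0 < s) (hp : 1 < p)
    {u : Rn n → ℝ} (hT : FluxIneq n s p C u) (hu : Measurable u)
    (hu4 : ∀ x, ‖x‖ < 4 → 0 ≤ u x) (htail : negTail n s p u ≤ 1) {τ : ℝ} (hτ : 0 ≤ τ) :
    upFlux n s p u (fun x => max (barrier u x - τ) 0) ≤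
      C * fluxConst n s p * ENNReal.ofReal (2 * 4 ^ p) * volume {x | τ < barrier u x} := by
  refine (hT (fun x => max (barrier u x - τ) 0)
    (((measurable_barrier hu).sub_const τ).max measurable_const)
    (fun x => le_max_right _ _) ⟨2, fun x => ?_⟩ (fun x hx => ?_) ⟨2, fun x y => ?_⟩).trans ?_
  · refine max_le ?_ (by norm_num)
    rw [barrier]
    linarith [le_max_right (u x) 0, cutoff_le_one (a := 2) (x := x)]
  · refine max_eq_right ?_
    rw [barrier, cutoff_eq_zero (by linarith)]
    linarith [le_max_right (u x) 0]
  · refine (abs_max_sub_max_le_max _ _ _ _).trans ?_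
    rw [sub_self, abs_zero, max_eq_left (abs_nonneg _), sub_sub_sub_cancel_right, barrier, barrier]
    have h1 := abs_cutoff_sub_le (a := 2) (x := x) (y := y)
    have h2 : |max (u x) 0 - max (u y) 0| ≤ |u x - u y| := by
      refine (abs_max_sub_max_le_max _ _ _ _).trans ?_
      rw [sub_self, abs_zero, max_eq_left (abs_nonneg _)]
    have h3 := min_le_right 1 ‖x - y‖
    have h4 := abs_sub (2 * (cutoff 2 x - cutoff 2 y)) (max (u x) 0 - max (u y) 0)
    rw [abs_mul, abs_two] at h4
    calc _ = |2 * (cutoff 2 x - cutoff 2 y) - (max (u x) 0 - max (u y) 0)| := by ring_nf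
      _ ≤ _ := h4
      _ ≤ _ := by linarith [abs_nonneg (u x - u y)]
  · calc _ ≤ C * (fluxConst n s p * (ENNReal.ofReal (2 * 4 ^ p) *
          volume {x | τ < barrier u x})) := by
          gcongr
          exact upFlux_neg_barrier_le hs hp hu hu4 htail hτ
      _ = _ := by ring

/-- A lower bound for a double integral over a family of sections. -/
theorem mul_volume_le_lintegral_lintegral {n : ℕ} {F : Rn n → Rn n → ℝ≥0∞} {A : Set (Rn n)}
    (hA : MeasurableSet A) {T : Rn n → Set (Rn n)} (hT : ∀ x ∈ A, MeasurableSet (T x))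
    {c m : ℝ≥0∞} (hm : ∀ x ∈ A, m ≤ volume (T x)) (h : ∀ x ∈ A, ∀ y ∈ T x, c ≤ F x y) :
    c * m * volume A ≤ ∫⁻ x, ∫⁻ y, F x y := by
  calc c * m * volume A = ∫⁻ _ in A, c * m := (setLIntegral_const _ _).symm
    _ ≤ ∫⁻ x in A, ∫⁻ y, F x y := by
      refine setLIntegral_mono' hA fun x hx => ?_
      calc c * m ≤ c * volume (T x) := by gcongr; exact hm x hx
        _ = ∫⁻ _ in T x, c := (setLIntegral_const _ _).symm
        _ ≤ ∫⁻ y in T x, F x y := setLIntegral_mono' (hT x hx) (h x hx)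
        _ ≤ _ := setLIntegral_le_lintegral _ _
    _ ≤ _ := setLIntegral_le_lintegral _ _

theorem volume_ball_eq_ofReal {n : ℕ} (x : Rn n) {ρ : ℝ} (hρ : 0 < ρ) :
    volume (ball x ρ) = ENNReal.ofReal ((volume (ball (0 : Rn n) 1)).toReal * ρ ^ n) := by
  rw [Measure.addHaar_ball_of_pos _ _ hρ, finrank_euclideanSpace_fin, mul_comm,
    ENNReal.ofReal_mul ENNReal.toReal_nonneg, ENNReal.ofReal_toReal measure_ball_lt_top.ne]

theorem volume_barrier_lt_top {n : ℕ} {u : Rn n → ℝ} {τ : ℝ} (hτ : 0 ≤ τ) :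
    volume {x | τ < barrier u x} < ⊤ := by
  refine (measure_mono (t := ball 0 2) fun x hx => ?_).trans_lt measure_ball_lt_top
  simpa using norm_lt_two_of_barrier_pos (hτ.trans_lt hx)

/-- A supersolution that is below `1` somewhere in `B_1` has a barrier that is large on a set of
definite measure. -/
theorem exists_le_volume_barrier {n : ℕ} {s p : ℝ} {C : ℝ≥0∞} (hn : 0 < n) (hs : 0 < s)
    (hs1 : s < 1) (hp : 1 < p) (hC : C ≠ ⊤) :
    ∃ ε : ℝ, 0 < ε ∧ ∀ u : Rn n → ℝ, Measurable u → FluxIneq n s p C u →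
      (∀ x, ‖x‖ < 4 → 0 ≤ u x) → negTail n s p u ≤ 1 →
      (¬ ∀ᵐ x ∂volume.restrict (ball (0 : Rn n) 1), 1 ≤ u x) →
      ENNReal.ofReal ε ≤ volume {x | 1 / 2 < barrier u x} := by
  set K := C * fluxConst n s p * ENNReal.ofReal (2 * 4 ^ p) with hK
  have hKt : K ≠ ⊤ := ENNReal.mul_ne_top (ENNReal.mul_ne_top hC (fluxConst_ne_top hn hs hs1 hp))
    ENNReal.ofReal_ne_top
  set ω := (volume (ball (0 : Rn n) 1)).toReal with hω
  have hω0 : 0 < ω := ENNReal.toReal_pos (measure_ball_pos _ _ one_pos).ne' measure_ball_lt_top.ne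
  obtain ⟨ε, hε, H⟩ := exists_small_forall_tendsto_zero (D := K.toReal) hn hs hs1 hp
    ENNReal.toReal_nonneg hω0
  refine ⟨ε, hε, fun u hu hT hu4 htail hinf => ?_⟩
  by_contra! hlt
  set τ : ℕ → ℝ := fun k => 1 - (1 / 2) ^ (k + 1) with hτ
  have hτ0 : ∀ k, 0 ≤ τ k := fun k => by
    have : (1 / 2 : ℝ) ^ (k + 1) ≤ 1 := pow_le_one₀ (by norm_num) (by norm_num)
    simp only [hτ]; linarith
  have hmeas : ∀ t, MeasurableSet {x | t < barrier u x} := fun t =>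
    measurableSet_lt measurable_const (measurable_barrier hu)
  have key := H (fun k => (volume {x | τ k < barrier u x}).toReal)
    (fun k => ENNReal.toReal_nonneg) ?_ ?_
  · refine hinf ?_
    rw [ae_restrict_iff' measurableSet_ball]
    have h0 : volume {x | 1 ≤ barrier u x} = 0 := by
      have h1 : (volume {x | 1 ≤ barrier u x}).toReal ≤ 0 := by
        refine ge_of_tendsto' key fun k => ?_
        refine ENNReal.toReal_mono (volume_barrier_lt_top (hτ0 k)).ne (measure_mono fun x hx => ?_)
        have h2 : (0 : ℝ) < (1 / 2) ^ (k + 1) := by positivity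
        simp only [mem_ofPred_eq, hτ] at hx ⊢
        linarith
      have h2 : volume {x | 1 ≤ barrier u x} ≠ ⊤ :=
        ((measure_mono fun x (hx : 1 ≤ barrier u x) =>
          (by linarith : (1 / 2 : ℝ) < barrier u x)).trans_lt
          (volume_barrier_lt_top (by norm_num))).ne
      simpa [h2] using (ENNReal.toReal_eq_zero_iff _).1 (le_antisymm h1 ENNReal.toReal_nonneg)
    rw [ae_iff]
    refine measure_mono_null (fun x hx => ?_) h0
    simp only [mem_ofPred_eq, Classical.not_imp, not_le, mem_ball, dist_zero_right] at hx ⊢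
    rw [barrier, cutoff_eq_one (by linarith)]
    have := max_le hx.2.le zero_le_one
    linarith
  · intro k ρ hρ hρk
    rcases le_or_gt (ω * ρ ^ n - (volume {x | τ k < barrier u x}).toReal) 0 with h0 | h0
    · refine le_trans ?_ (mul_nonneg ENNReal.toReal_nonneg ENNReal.toReal_nonneg)
      refine mul_nonpos_of_nonneg_of_nonpos ENNReal.toReal_nonneg ?_
      exact mul_nonpos_of_nonneg_of_nonpos (by positivity) h0
    have hδ : (0 : ℝ) < (1 / 2) ^ (k + 3) := by positivity
    have hδ2 : (1 / 2 : ℝ) ^ (k + 4) = (1 / 2) ^ (k + 3) / 2 := by ring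
    have hτk : τ (k + 1) = τ k + 2 * (1 / 2) ^ (k + 3) := by simp only [hτ]; ring
    have h1 := (mul_volume_le_lintegral_lintegral (hmeas (τ (k + 1)))
      (T := fun x => ball x ρ \ {x | τ k < barrier u x})
      (fun x _ => measurableSet_ball.diff (hmeas _))
      (c := ENNReal.ofReal (((1 / 2 : ℝ) ^ (k + 3)) ^ p * ρ ^ (-((n : ℝ) + s * p))))
      (m := ENNReal.ofReal (ω * ρ ^ n - (volume {x | τ k < barrier u x}).toReal))
      (fun x _ => ?_) (fun x hx y hy => ?_)).trans
      (hT.barrier_le hs hp hu hu4 htail (hτ0 k))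
    · rw [← hK] at h1
      have h2 := ENNReal.toReal_mono
        (ENNReal.mul_ne_top hKt (volume_barrier_lt_top (hτ0 k)).ne) h1
      rw [ENNReal.toReal_mul, ENNReal.toReal_mul, ENNReal.toReal_mul,
        ENNReal.toReal_ofReal (by positivity), ENNReal.toReal_ofReal h0.le] at h2
      linarith
    · refine le_trans ?_ le_measure_sdiff
      rw [volume_ball_eq_ofReal x hρ, ENNReal.ofReal_sub _ ENNReal.toReal_nonneg,
        ENNReal.ofReal_toReal (volume_barrier_lt_top (hτ0 k)).ne]
    · apply ENNReal.ofReal_le_ofReal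
      obtain ⟨hy1, hy2⟩ := hy
      simp only [mem_ofPred_eq, not_lt, mem_ball] at hx hy1 hy2
      rw [dist_comm, dist_eq_norm] at hy1
      beta_reduce
      rw [max_eq_left (by linarith : 0 ≤ barrier u x - τ k),
        max_eq_right (by linarith : barrier u y - τ k ≤ 0)]
      have hne : x ≠ y := by
        rintro rfl
        linarith
      have hc := (abs_le.1 (abs_cutoff_sub_le (a := 2) (x := x) (y := y))).2
      have hc2 := min_le_right 1 ‖x - y‖
      have h3 : (1 / 2) ^ (k + 3) ≤ max (u y) 0 - max (u x) 0 := by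
        rw [barrier] at hx hy2
        linarith
      have h4 : (1 / 2) ^ (k + 3) ≤ u y - u x := by
        have h5 := le_max_left (u x) 0
        have h6 := le_max_right (u x) 0
        rcases max_choice (u y) 0 with h | h <;> rw [h] at h3 <;> linarith
      have h7 : 0 < ‖x - y‖ := norm_pos_iff.2 (sub_ne_zero.2 hne)
      rw [max_eq_left (by linarith : 0 ≤ u y - u x), max_eq_left (by linarith)]
      calc _ = ((1 / 2 : ℝ) ^ (k + 3)) ^ (p - 1) * (1 / 2) ^ (k + 3) *
            ρ ^ (-((n : ℝ) + s * p)) := by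
            rw [← Real.rpow_add_one hδ.ne']; simp
        _ ≤ _ := by
          refine mul_le_mul (mul_le_mul (Real.rpow_le_rpow hδ.le h4 (by linarith)) (by linarith)
            hδ.le (Real.rpow_nonneg (by linarith) _)) ?_ (by positivity)
            (mul_nonneg (Real.rpow_nonneg (by linarith) _) (by linarith))
          refine Real.rpow_le_rpow_of_nonpos h7 hy1.le ?_
          have : 0 < s * p := by positivity
          have : (0 : ℝ) ≤ n := n.cast_nonneg
          linarith
  · have h : τ 0 = 1 / 2 := by simp only [hτ]; norm_num
    simp only [h]
    exact ENNReal.toReal_le_of_le_ofReal hε.le hlt.le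

/-- A local bound for the integral of `(1 + u₊) ^ (p - 1)` for supersolutions that are below `1`
somewhere in `B_1`. -/
theorem exists_lintegral_rpow_le {n : ℕ} {s p : ℝ} {C : ℝ≥0∞} (hn : 0 < n) (hs : 0 < s)
    (hs1 : s < 1) (hp : 1 < p) (hC : C ≠ ⊤) :
    ∃ M : ℝ≥0∞, M ≠ ⊤ ∧ ∀ u : Rn n → ℝ, Measurable u → FluxIneq n s p C u →
      (∀ x, ‖x‖ < 4 → 0 ≤ u x) → negTail n s p u ≤ 1 →
      (¬ ∀ᵐ x ∂volume.restrict (ball (0 : Rn n) 1), 1 ≤ u x) →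
      ∫⁻ x in ball 0 4, ENNReal.ofReal ((1 + max (u x) 0) ^ (p - 1)) ≤ M := by
  obtain ⟨ε, hε, H⟩ := exists_le_volume_barrier hn hs hs1 hp hC
  set K := C * fluxConst n s p * ENNReal.ofReal (2 * 4 ^ p) with hK
  have hKt : K ≠ ⊤ := ENNReal.mul_ne_top (ENNReal.mul_ne_top hC (fluxConst_ne_top hn hs hs1 hp))
    ENNReal.ofReal_ne_top
  set e := (n : ℝ) + s * p with he
  have he0 : 0 ≤ e := by positivity
  set c := (2 : ℝ) ^ (1 - p) * (1 / 2) * 6 ^ (-e) with hc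
  have hc0 : 0 < c := by positivity
  set I := K * volume (ball (0 : Rn n) 2) * (ENNReal.ofReal ε * ENNReal.ofReal c)⁻¹ with hI
  have hIt : I ≠ ⊤ := ENNReal.mul_ne_top (ENNReal.mul_ne_top hKt measure_ball_lt_top.ne)
    (ENNReal.inv_ne_top.2 (mul_ne_zero (by simpa using hε) (by simpa using hc0)))
  refine ⟨ENNReal.ofReal (2 ^ (p - 1)) * (I + ENNReal.ofReal (4 ^ (p - 1) + 1) *
    volume (ball (0 : Rn n) 4)), ENNReal.mul_ne_top ENNReal.ofReal_ne_top (ENNReal.add_ne_top.2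
    ⟨hIt, ENNReal.mul_ne_top ENNReal.ofReal_ne_top measure_ball_lt_top.ne⟩),
    fun u hu hT hu4 htail hinf => ?_⟩
  have hvol := H u hu hT hu4 htail hinf
  set S := ball (0 : Rn n) 4 ∩ {x | 4 ≤ u x} with hS
  have hSm : MeasurableSet S := measurableSet_ball.inter (measurableSet_le measurable_const hu)
  have hAm : MeasurableSet {x | 1 / 2 < barrier u x} :=
    measurableSet_lt measurable_const (measurable_barrier hu)
  have hum : Measurable fun x => ENNReal.ofReal (u x ^ (p - 1)) := by fun_prop
  have h1 : ∫⁻ x in S, ENNReal.ofReal (u x ^ (p - 1)) ≤ I := by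
    rw [hI, ← div_eq_mul_inv, ENNReal.le_div_iff_mul_le
      (Or.inl (mul_ne_zero (by simpa using hε) (by simpa using hc0)))
      (Or.inl (ENNReal.mul_ne_top ENNReal.ofReal_ne_top ENNReal.ofReal_ne_top))]
    calc _ ≤ (∫⁻ y in S, ENNReal.ofReal (u y ^ (p - 1))) *
          (volume {x | 1 / 2 < barrier u x} * ENNReal.ofReal c) := by gcongr
      _ = ∫⁻ _ in {x | 1 / 2 < barrier u x},
          ENNReal.ofReal c * ∫⁻ y in S, ENNReal.ofReal (u y ^ (p - 1)) := by
          rw [setLIntegral_const]; ring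
      _ ≤ ∫⁻ x in {x | 1 / 2 < barrier u x}, ∫⁻ y, ENNReal.ofReal (max (u y - u x) 0 ^ (p - 1) *
            max (max (barrier u x - 0) 0 - max (barrier u y - 0) 0) 0 * ‖x - y‖ ^ (-e)) := by
          refine setLIntegral_mono' hAm fun x hx => ?_
          rw [← lintegral_const_mul _ hum]
          refine (setLIntegral_mono' hSm fun y hy => ?_).trans (setLIntegral_le_lintegral _ _)
          rw [← ENNReal.ofReal_mul hc0.le]
          apply ENNReal.ofReal_le_ofReal
          obtain ⟨hy1, hy2⟩ := hy
          simp only [mem_ofPred_eq, mem_ball, dist_zero_right] at hx hy1 hy2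
          have hx2 := norm_lt_two_of_barrier_pos (u := u) (x := x) (by linarith)
          have hux : u x ≤ 2 := by
            rw [barrier] at hx
            linarith [le_max_left (u x) 0, cutoff_le_one (a := 2) (x := x)]
          have hby : barrier u y ≤ 0 := by
            rw [barrier]
            linarith [le_max_left (u y) 0, cutoff_le_one (a := 2) (x := y)]
          have hne : x ≠ y := by
            rintro rfl
            linarith
          have h7 : 0 < ‖x - y‖ := norm_pos_iff.2 (sub_ne_zero.2 hne)
          have h8 : ‖x - y‖ ≤ 6 := by linarith [norm_sub_le x y]
          rw [max_eq_left (by linarith : 0 ≤ u y - u x), sub_zero, sub_zero, max_eq_right hby,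
            max_eq_left (by linarith : 0 ≤ barrier u x), sub_zero,
            max_eq_left (by linarith : 0 ≤ barrier u x)]
          calc _ = (u y / 2) ^ (p - 1) * (1 / 2) * 6 ^ (-e) := by
                rw [hc, Real.div_rpow (by linarith) (by norm_num),
                  show 1 - p = -(p - 1) by ring, Real.rpow_neg (by norm_num)]
                ring
            _ ≤ _ := by
              refine mul_le_mul (mul_le_mul (Real.rpow_le_rpow (by linarith) (by linarith)
                (by linarith)) (by linarith) (by norm_num) (Real.rpow_nonneg (by linarith) _)) ?_
                (by positivity) (mul_nonneg (Real.rpow_nonneg (by linarith) _) (by linarith))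
              exact Real.rpow_le_rpow_of_nonpos h7 h8 (by linarith)
      _ ≤ upFlux n s p u (fun x => max (barrier u x - 0) 0) := setLIntegral_le_lintegral _ _
      _ ≤ K * volume {x | 0 < barrier u x} := hT.barrier_le hs hp hu hu4 htail le_rfl
      _ ≤ _ := by
        gcongr
        intro x hx
        simpa using norm_lt_two_of_barrier_pos hx
  have hum2 : Measurable (S.indicator fun x => ENNReal.ofReal (u x ^ (p - 1))) := hum.indicator hSm
  calc ∫⁻ x in ball 0 4, ENNReal.ofReal ((1 + max (u x) 0) ^ (p - 1))
      ≤ ∫⁻ x in ball (0 : Rn n) 4, ENNReal.ofReal (2 ^ (p - 1)) *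
        (S.indicator (fun x => ENNReal.ofReal (u x ^ (p - 1))) x +
          ENNReal.ofReal (4 ^ (p - 1) + 1)) := by
        refine setLIntegral_mono' measurableSet_ball fun x hx => ?_
        have hx0 : 0 ≤ u x := hu4 x (by simpa using hx)
        rw [max_eq_left hx0]
        by_cases h : x ∈ S
        · rw [indicator_of_mem h, ← ENNReal.ofReal_add (by positivity) (by positivity),
            ← ENNReal.ofReal_mul (by positivity)]
          apply ENNReal.ofReal_le_ofReal
          refine (Real.add_rpow_le_two_rpow_mul zero_le_one hx0 (by linarith)).trans ?_
          have : (0 : ℝ) ≤ 4 ^ (p - 1) := by positivity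
          rw [Real.one_rpow]
          gcongr ?_ * ?_
          linarith
        · rw [indicator_of_notMem h, zero_add, ← ENNReal.ofReal_mul (by positivity)]
          apply ENNReal.ofReal_le_ofReal
          have hx4 : u x ≤ 4 := by
            by_contra! h4
            exact h ⟨hx, h4.le⟩
          refine (Real.add_rpow_le_two_rpow_mul zero_le_one hx0 (by linarith)).trans ?_
          rw [Real.one_rpow, add_comm]
          gcongr
    _ ≤ _ := by
        rw [lintegral_const_mul _ (hum2.add_const _)]
        gcongr
        rw [lintegral_add_right _ measurable_const, setLIntegral_const]
        gcongr
        rw [setLIntegral_indicator hSm]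
        exact (lintegral_mono_set inter_subset_left).trans h1

theorem Real.one_add_mul_le_rpow_neg {r κ : ℝ} (hr : 0 < r) (hκ : 0 ≤ κ) :
    1 + κ * (1 - r) ≤ r ^ (-κ) := by
  rw [Real.rpow_def_of_pos hr]
  nlinarith [Real.add_one_le_exp (Real.log r * -κ), Real.log_le_sub_one_of_pos hr]

theorem Real.mul_le_rpow_neg_sub_rpow_neg {X Y κ : ℝ} (hX : 0 < X) (hY : 0 < Y) (hκ : 0 ≤ κ) :
    κ * (Y - X) * Y ^ (-(κ + 1)) ≤ X ^ (-κ) - Y ^ (-κ) := by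
  have h1 := Real.one_add_mul_le_rpow_neg (r := X / Y) (by positivity) hκ
  have h2 : 0 < Y ^ (-κ) := by positivity
  rw [Real.div_rpow hX.le hY.le, le_div_iff₀ h2] at h1
  have h3 : Y ^ (-(κ + 1)) = Y ^ (-κ) / Y := by
    rw [neg_add, ← sub_eq_add_neg, Real.rpow_sub_one hY.ne']
  rw [h3]
  have h4 : κ * (Y - X) * (Y ^ (-κ) / Y) = κ * (1 - X / Y) * Y ^ (-κ) := by
    field_simp
  linarith

theorem Real.abs_rpow_neg_sub_rpow_neg_le {X Y κ : ℝ} (hX : 1 ≤ X) (hY : 1 ≤ Y) (hκ : 0 ≤ κ) :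
    |X ^ (-κ) - Y ^ (-κ)| ≤ κ * |X - Y| := by
  wlog h : X ≤ Y generalizing X Y
  · rw [abs_sub_comm, abs_sub_comm X]
    exact this hY hX (by linarith)
  have h1 := Real.mul_le_rpow_neg_sub_rpow_neg (X := Y) (Y := X) (by linarith) (by linarith) hκ
  have h2 : X ^ (-(κ + 1)) ≤ 1 := Real.rpow_le_one_of_one_le_of_nonpos hX (by linarith)
  have h3 : Y ^ (-κ) ≤ X ^ (-κ) := Real.rpow_le_rpow_of_nonpos (by linarith) h (by linarith)
  rw [abs_of_nonneg (by linarith), abs_sub_comm, abs_of_nonneg (by linarith)]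
  nlinarith [mul_nonneg hκ (sub_nonneg.2 h)]

theorem Real.one_sub_rpow_le {t a : ℝ} (ht : 0 ≤ t) (ha : 1 ≤ a) : 1 - t ^ a ≤ a * (1 - t) := by
  have := one_add_mul_self_le_rpow_one_add (s := t - 1) (by linarith) ha
  rw [add_sub_cancel] at this
  linarith

theorem Real.abs_rpow_sub_rpow_le {a b p : ℝ} (ha : 0 ≤ a) (hb : 0 ≤ b) (ha1 : a ≤ 1)
    (hb1 : b ≤ 1) (hp : 1 ≤ p) : |a ^ p - b ^ p| ≤ p * |a - b| := by
  wlog h : a ≤ b generalizing a b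
  · rw [abs_sub_comm, abs_sub_comm a]
    exact this hb ha hb1 ha1 (by linarith)
  rcases hb.eq_or_lt with rfl | hb0
  · rw [le_antisymm h ha]; simp
  have h1 := Real.one_sub_rpow_le (t := a / b) (by positivity) hp
  have hbp : 0 < b ^ p := by positivity
  rw [Real.div_rpow ha hb] at h1
  have h2 : b ^ p - a ^ p ≤ p * (1 - a / b) * b ^ p := by
    calc b ^ p - a ^ p = (1 - a ^ p / b ^ p) * b ^ p := by field_simp
      _ ≤ _ := by gcongr
  have h3 : b ^ p ≤ b := by
    simpa using Real.rpow_le_rpow_of_exponent_ge hb0 hb1 hp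
  have h4 : a ^ p ≤ b ^ p := Real.rpow_le_rpow ha h (by linarith)
  have h5 : 0 ≤ 1 - a / b := by rw [sub_nonneg, div_le_one hb0]; exact h
  rw [abs_sub_comm, abs_of_nonneg (by linarith), abs_sub_comm, abs_of_nonneg (by linarith)]
  calc b ^ p - a ^ p ≤ p * (1 - a / b) * b ^ p := h2
    _ ≤ p * (1 - a / b) * b := by gcongr
    _ = _ := by field_simp

/-- The algebraic inequality behind the logarithmic-type energy estimate. -/
theorem Real.rpow_mul_weight_sub_le {p κ a b X Y : ℝ} (hp : 1 < p) (hκ : 0 < κ) (hκp : κ ≤ p)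
    (hX : 1 ≤ X) (hXY : X ≤ Y) (ha : 0 ≤ a) (hb : 0 ≤ b)
    (h : a ^ p * X ^ (-κ) < b ^ p * Y ^ (-κ)) :
    a < b ∧ (Y - X) ^ (p - 1) * (b ^ p * Y ^ (-κ) - a ^ p * X ^ (-κ)) ≤
      (p / κ) ^ (p - 1) * p * Y ^ (p - 1) * (b - a) ^ p := by
  have hY : 1 ≤ Y := hX.trans hXY
  have hX0 : 0 < X := by linarith
  have hY0 : 0 < Y := by linarith
  have hXk : 0 < X ^ (-κ) := by positivity
  have hYk : 0 < Y ^ (-κ) := by positivity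
  have hYX : Y ^ (-κ) ≤ X ^ (-κ) := Real.rpow_le_rpow_of_nonpos hX0 hXY (by linarith)
  have hap : 0 ≤ a ^ p := by positivity
  have hbp : a ^ p < b ^ p := by
    by_contra! h1
    have h2 : b ^ p * Y ^ (-κ) ≤ a ^ p * X ^ (-κ) := by gcongr
    linarith
  have hab : a < b := by
    by_contra! h1
    linarith [Real.rpow_le_rpow hb h1 (by linarith : 0 ≤ p)]
  refine ⟨hab, ?_⟩
  have hb0 : 0 < b := by linarith
  set t := a / b with ht
  have ht0 : 0 ≤ t := by positivity
  have ht1 : t < 1 := by rw [ht, div_lt_one hb0]; exact hab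
  have hbt : b - a = b * (1 - t) := by rw [ht]; field_simp
  have hat : a ^ p = t ^ p * b ^ p := by
    rw [ht, Real.div_rpow ha hb]
    field_simp
  have hbpp : 0 < b ^ p := by positivity
  have h1 : t ^ p < (X / Y) ^ κ := by
    rw [Real.div_rpow hX0.le hY0.le, lt_div_iff₀ (by positivity)]
    rw [hat, Real.rpow_neg hX0.le, Real.rpow_neg hY0.le] at h
    have hXk' : 0 < X ^ κ := by positivity
    have hYk' : 0 < Y ^ κ := by positivity
    rw [← div_eq_mul_inv, ← div_eq_mul_inv, div_lt_div_iff₀ hXk' hYk'] at h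
    nlinarith
  have h2 : t ^ (p / κ) ≤ X / Y := by
    have := Real.rpow_le_rpow (by positivity) h1.le (by positivity : 0 ≤ 1 / κ)
    rw [← Real.rpow_mul ht0, ← Real.rpow_mul (by positivity), mul_one_div_cancel hκ.ne',
      Real.rpow_one, mul_one_div] at this
    exact this
  have h3 := Real.one_sub_rpow_le ht0 (a := p / κ) (by rw [le_div_iff₀ hκ]; linarith)
  have h4 : Y - X ≤ p / κ * (1 - t) * Y := by
    have : Y - X = (1 - X / Y) * Y := by field_simp
    rw [this]
    gcongr
    linarith
  have h5 : b ^ p * Y ^ (-κ) - a ^ p * X ^ (-κ) ≤ p * (1 - t) * b ^ p := by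
    have h6 := Real.one_sub_rpow_le ht0 hp.le
    calc b ^ p * Y ^ (-κ) - a ^ p * X ^ (-κ) ≤ b ^ p * Y ^ (-κ) - a ^ p * Y ^ (-κ) := by gcongr
      _ = (b ^ p - a ^ p) * Y ^ (-κ) := by ring
      _ ≤ (b ^ p - a ^ p) * 1 := by
        have := Real.rpow_le_one_of_one_le_of_nonpos hY (by linarith : -κ ≤ 0)
        gcongr
      _ = (1 - t ^ p) * b ^ p := by rw [hat]; ring
      _ ≤ _ := by gcongr
  have h1t : 0 < 1 - t := by linarith
  calc _ ≤ (p / κ * (1 - t) * Y) ^ (p - 1) * (p * (1 - t) * b ^ p) := by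
        refine mul_le_mul (Real.rpow_le_rpow (by linarith) h4 (by linarith)) h5 (by linarith)
          (by positivity)
    _ = (p / κ) ^ (p - 1) * p * Y ^ (p - 1) * (((1 - t) ^ (p - 1) * (1 - t)) * b ^ p) := by
        rw [Real.mul_rpow (by positivity) hY0.le, Real.mul_rpow (by positivity) h1t.le]
        ring
    _ = _ := by
        rw [← Real.rpow_add_one h1t.ne', sub_add_cancel, hbt, Real.mul_rpow hb h1t.le]
        ring

/-- The test function of the logarithmic-type energy estimate. -/
def weightTest {n : ℕ} (p κ : ℝ) (u : Rn n → ℝ) (x : Rn n) : ℝ :=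
  cutoff 3 x ^ p * (1 + max (u x) 0) ^ (-κ)

theorem measurable_weightTest {n : ℕ} {p κ : ℝ} {u : Rn n → ℝ} (hu : Measurable u) :
    Measurable (weightTest p κ u) := by
  have := measurable_cutoff (n := n) (a := 3)
  unfold weightTest
  fun_prop

theorem upFlux_weightTest_le {n : ℕ} {s p κ : ℝ} {C : ℝ≥0∞} (hs : 0 < s) (hp : 1 < p)
    (hκ : 0 < κ) (hκp : κ ≤ p) {u : Rn n → ℝ} (hT : FluxIneq n s p C u) (hu : Measurable u)
    (hu4 : ∀ x, ‖x‖ < 4 → 0 ≤ u x) (htail : negTail n s p u ≤ 1) :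
    upFlux n s p u (weightTest p κ u) ≤ C * (fluxConst n s p *
      (ENNReal.ofReal ((p / κ) ^ (p - 1) * p + 2 ^ (p - 1)) *
        ∫⁻ x in ball 0 4, ENNReal.ofReal ((1 + max (u x) 0) ^ (p - 1)))) := by
  have hU1 : ∀ x, 1 ≤ 1 + max (u x) 0 := fun x => by linarith [le_max_right (u x) 0]
  have hU0 : ∀ x, 0 < 1 + max (u x) 0 := fun x => by linarith [hU1 x]
  have hφ1 : ∀ x, weightTest p κ u x ≤ 1 := fun x =>
    mul_le_one₀ (Real.rpow_le_one cutoff_nonneg cutoff_le_one (by linarith))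
      (Real.rpow_nonneg (hU0 x).le _)
      (Real.rpow_le_one_of_one_le_of_nonpos (hU1 x) (by linarith))
  have hφ0 : ∀ x, 0 ≤ weightTest p κ u x := fun x =>
    mul_nonneg (Real.rpow_nonneg cutoff_nonneg _) (Real.rpow_nonneg (hU0 x).le _)
  have hφ3 : ∀ x, 3 ≤ ‖x‖ → weightTest p κ u x = 0 := fun x hx => by
    rw [weightTest, cutoff_eq_zero hx, Real.zero_rpow (by linarith), zero_mul]
  refine (hT _ (measurable_weightTest hu) hφ0 ⟨1, hφ1⟩ hφ3 ⟨p + κ, fun x y => ?_⟩).trans ?_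
  · have h1 := Real.abs_rpow_sub_rpow_le (cutoff_nonneg (a := 3) (x := x))
      (cutoff_nonneg (a := 3) (x := y)) cutoff_le_one cutoff_le_one hp.le
    have h2 := Real.abs_rpow_neg_sub_rpow_neg_le (hU1 x) (hU1 y) hκ.le
    have h3 := (abs_cutoff_sub_le (a := 3) (x := x) (y := y)).trans (min_le_right _ _)
    have h4 : |1 + max (u x) 0 - (1 + max (u y) 0)| ≤ |u x - u y| := by
      rw [add_sub_add_left_eq_sub]
      refine (abs_max_sub_max_le_max _ _ _ _).trans ?_
      rw [sub_self, abs_zero, max_eq_left (abs_nonneg _)]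
    have h5 : (1 + max (u x) 0) ^ (-κ) ≤ 1 :=
      Real.rpow_le_one_of_one_le_of_nonpos (hU1 x) (by linarith)
    have h6 : 0 ≤ (1 + max (u x) 0) ^ (-κ) := Real.rpow_nonneg (hU0 x).le _
    have h7 : cutoff 3 y ^ p ≤ 1 := Real.rpow_le_one cutoff_nonneg cutoff_le_one (by linarith)
    have h8 : 0 ≤ cutoff 3 y ^ p := Real.rpow_nonneg cutoff_nonneg _
    calc |weightTest p κ u x - weightTest p κ u y|
        = |(cutoff 3 x ^ p - cutoff 3 y ^ p) * (1 + max (u x) 0) ^ (-κ) +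
          cutoff 3 y ^ p * ((1 + max (u x) 0) ^ (-κ) - (1 + max (u y) 0) ^ (-κ))| := by
          rw [weightTest, weightTest]; ring_nf
      _ ≤ |cutoff 3 x ^ p - cutoff 3 y ^ p| * 1 +
          1 * |(1 + max (u x) 0) ^ (-κ) - (1 + max (u y) 0) ^ (-κ)| := by
          refine (abs_add_le _ _).trans ?_
          rw [abs_mul, abs_mul, abs_of_nonneg h6, abs_of_nonneg h8]
          gcongr
      _ ≤ p * ‖x - y‖ + κ * |u x - u y| := by
          rw [mul_one, one_mul]
          refine add_le_add (h1.trans ?_) (h2.trans ?_) <;> gcongr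
      _ ≤ _ := by nlinarith [abs_nonneg (u x - u y), norm_nonneg (x - y)]
  · gcongr
    set D := (p / κ) ^ (p - 1) * p + 2 ^ (p - 1) with hD
    have hD1 : 0 ≤ (p / κ) ^ (p - 1) * p := by positivity
    have hD2 : (0 : ℝ) ≤ 2 ^ (p - 1) := by positivity
    have hD0 : 0 ≤ D := by positivity
    have hUm : Measurable fun x => (1 + max (u x) 0) ^ (p - 1) := by fun_prop
    refine (upFlux_neg_le (b := (ball 0 4).indicator fun x => D * (1 + max (u x) 0) ^ (p - 1))
      hs hp hu ((hUm.const_mul _).indicator measurableSet_ball)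
      (fun y => indicator_nonneg (fun z _ => mul_nonneg hD0 (Real.rpow_nonneg (hU0 z).le _)) y)
      htail ?_).trans_eq ?_
    · intro x y hxy hφ
      have hy3 : ‖y‖ < 3 := by
        by_contra! h
        linarith [hφ3 y h, hφ0 x]
      have hUy : 0 ≤ (1 + max (u y) 0) ^ (p - 1) := Real.rpow_nonneg (hU0 y).le _
      rw [indicator_of_mem (by simpa using by linarith)]
      rcases le_or_gt 0 (u x) with hx | hx
      · left
        have hXY : 1 + max (u x) 0 ≤ 1 + max (u y) 0 := by gcongr
        obtain ⟨h1, h2⟩ := Real.rpow_mul_weight_sub_le hp hκ hκp (hU1 x) hXY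
          (cutoff_nonneg (a := 3) (x := x)) (cutoff_nonneg (a := 3) (x := y)) hφ
        have h3 := (abs_le.1 (abs_cutoff_sub_le (a := 3) (x := x) (y := y))).1
        have h4 : u y - u x = 1 + max (u y) 0 - (1 + max (u x) 0) := by
          rw [max_eq_left hx, max_eq_left (hx.trans hxy.le)]; ring
        rw [h4]
        refine h2.trans (mul_le_mul ?_ (Real.rpow_le_rpow (by linarith) (by linarith)
          (by linarith)) (Real.rpow_nonneg (by linarith) _) (by positivity))
        gcongr
        linarith
      · right
        have hy0 := hu4 y (by linarith)
        refine ⟨?_, hy3.le, ?_⟩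
        · by_contra! h
          linarith [hu4 x h]
        rw [max_eq_left hy0, max_eq_left (by linarith : 0 ≤ -u x)] at *
        have h6 : 0 ≤ (-u x) ^ (p - 1) := Real.rpow_nonneg (by linarith) _
        have h7 : 1 ≤ (1 + u y) ^ (p - 1) := Real.one_le_rpow (by linarith) (by linarith)
        calc _ ≤ (1 + u y + -u x) ^ (p - 1) * 1 := by
              refine mul_le_mul (Real.rpow_le_rpow (by linarith) (by linarith) (by linarith))
                (by linarith [hφ0 x, hφ1 y]) (by linarith) (Real.rpow_nonneg (by linarith) _)
          _ ≤ 2 ^ (p - 1) * ((1 + u y) ^ (p - 1) + (-u x) ^ (p - 1)) := by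
              rw [mul_one]
              exact Real.add_rpow_le_two_rpow_mul (by linarith) (by linarith) (by linarith)
          _ ≤ 2 ^ (p - 1) * ((1 + u y) ^ (p - 1) * (1 + (-u x) ^ (p - 1))) := by
              gcongr
              nlinarith
          _ ≤ _ := by
              rw [mul_assoc]
              gcongr
              linarith
    · congr 1
      rw [← lintegral_const_mul _ hUm.ennreal_ofReal, ← lintegral_indicator measurableSet_ball]
      refine lintegral_congr fun x => ?_
      by_cases h : x ∈ ball (0 : Rn n) 4
      · rw [indicator_of_mem h, indicator_of_mem h, ENNReal.ofReal_mul hD0]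
      · rw [indicator_of_notMem h, indicator_of_notMem h, ENNReal.ofReal_zero]

set_option maxHeartbeats 1000000 in
/-- Weighted fractional energy estimate in `B_2`. -/
theorem exists_weighted_energy_le {n : ℕ} {s p κ : ℝ} {C : ℝ≥0∞} (hn : 0 < n) (hs : 0 < s)
    (hs1 : s < 1) (hp : 1 < p) (hκ : 0 < κ) (hκp : κ ≤ p) (hC : C ≠ ⊤) :
    ∃ M : ℝ≥0∞, M ≠ ⊤ ∧ ∀ u : Rn n → ℝ, Measurable u → FluxIneq n s p C u →
      (∀ x, ‖x‖ < 4 → 0 ≤ u x) → negTail n s p u ≤ 1 →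
      (¬ ∀ᵐ x ∂volume.restrict (ball (0 : Rn n) 1), 1 ≤ u x) →
      ∫⁻ x in ball 0 2, ∫⁻ y in ball 0 2, ENNReal.ofReal (|u x - u y| ^ p *
        (1 + max (u x) (u y)) ^ (-(κ + 1)) * ‖x - y‖ ^ (-((n : ℝ) + s * p))) ≤ M := by
  obtain ⟨M, hM, H⟩ := exists_lintegral_rpow_le hn hs hs1 hp hC
  set M₁ := C * (fluxConst n s p *
    (ENNReal.ofReal ((p / κ) ^ (p - 1) * p + 2 ^ (p - 1)) * M)) with hM₁
  have hM₁t : M₁ ≠ ⊤ := ENNReal.mul_ne_top hC (ENNReal.mul_ne_top (fluxConst_ne_top hn hs hs1 hp)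
    (ENNReal.mul_ne_top ENNReal.ofReal_ne_top hM))
  refine ⟨ENNReal.ofReal κ⁻¹ * (M₁ + M₁), ENNReal.mul_ne_top ENNReal.ofReal_ne_top
    (ENNReal.add_ne_top.2 ⟨hM₁t, hM₁t⟩), fun u hu hT hu4 htail hinf => ?_⟩
  have hflux : upFlux n s p u (weightTest p κ u) ≤ M₁ :=
    (upFlux_weightTest_le hs hp hκ hκp hT hu hu4 htail).trans (by
      rw [hM₁]; gcongr; exact H u hu hT hu4 htail hinf)
  set G : Rn n → Rn n → ℝ≥0∞ := fun x y => ENNReal.ofReal (max (u y - u x) 0 ^ (p - 1) *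
    max (weightTest p κ u x - weightTest p κ u y) 0 * ‖x - y‖ ^ (-((n : ℝ) + s * p))) with hG
  have hwm := measurable_weightTest (p := p) (κ := κ) hu
  have hGm : Measurable (Function.uncurry G) := by
    simp only [hG, Function.uncurry_def]
    fun_prop
  have hGm1 : ∀ x, Measurable (G x) := fun x => hGm.comp measurable_prodMk_left
  have hGm2 : ∀ x, Measurable fun y => G y x := fun x => hGm.comp measurable_prodMk_right
  have hpt0 : ∀ x y, ‖x‖ < 2 → ‖y‖ < 2 → u x ≤ u y → ENNReal.ofReal (|u x - u y| ^ p *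
      (1 + max (u x) (u y)) ^ (-(κ + 1)) * ‖x - y‖ ^ (-((n : ℝ) + s * p))) ≤
      ENNReal.ofReal κ⁻¹ * G x y := by
    intro x y hx hy hxy
    rw [hG, ← ENNReal.ofReal_mul (by positivity)]
    apply ENNReal.ofReal_le_ofReal
    have hux := hu4 x (by linarith)
    have huy := hu4 y (by linarith)
    have h1 := Real.mul_le_rpow_neg_sub_rpow_neg (X := 1 + u x) (Y := 1 + u y) (by linarith)
      (by linarith) hκ.le
    have hk : 0 ≤ ‖x - y‖ ^ (-((n : ℝ) + s * p)) := by positivity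
    have hYp : 0 ≤ (1 + u y) ^ (-(κ + 1)) := Real.rpow_nonneg (by linarith) _
    have h0 : 0 ≤ κ * (1 + u y - (1 + u x)) * (1 + u y) ^ (-(κ + 1)) :=
      mul_nonneg (mul_nonneg hκ.le (by linarith)) hYp
    rw [max_eq_right hxy, abs_sub_comm, abs_of_nonneg (by linarith),
      max_eq_left (by linarith : 0 ≤ u y - u x), weightTest, weightTest,
      cutoff_eq_one (by linarith), cutoff_eq_one (by linarith), max_eq_left hux, max_eq_left huy,
      Real.one_rpow, one_mul, one_mul, max_eq_left (by linarith), ← mul_assoc]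
    refine mul_le_mul_of_nonneg_right ?_ hk
    rw [← mul_assoc, mul_comm κ⁻¹, mul_assoc]
    have h2 : (u y - u x) ^ p = (u y - u x) ^ (p - 1) * (u y - u x) := by
      rcases (sub_nonneg.2 hxy).eq_or_lt with h | h
      · rw [← h, Real.zero_rpow (by linarith), mul_zero]
      · rw [← Real.rpow_add_one h.ne', sub_add_cancel]
    rw [h2, mul_assoc]
    refine mul_le_mul_of_nonneg_left ?_ (Real.rpow_nonneg (by linarith) _)
    rw [le_inv_mul_iff₀ hκ]
    linarith
  have hpt : ∀ x y, ‖x‖ < 2 → ‖y‖ < 2 → ENNReal.ofReal (|u x - u y| ^ p *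
      (1 + max (u x) (u y)) ^ (-(κ + 1)) * ‖x - y‖ ^ (-((n : ℝ) + s * p))) ≤
      ENNReal.ofReal κ⁻¹ * (G x y + G y x) := by
    intro x y hx hy
    rcases le_total (u x) (u y) with h | h
    · refine (hpt0 x y hx hy h).trans ?_
      gcongr
      exact le_self_add
    · rw [abs_sub_comm, max_comm, norm_sub_rev]
      refine (hpt0 y x hy hx h).trans ?_
      gcongr
      exact le_add_self
  calc _ ≤ ∫⁻ x in ball 0 2, ∫⁻ y in ball 0 2, ENNReal.ofReal κ⁻¹ * (G x y + G y x) := by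
        refine setLIntegral_mono' measurableSet_ball fun x hx =>
          setLIntegral_mono' measurableSet_ball fun y hy => hpt x y (by simpa using hx)
            (by simpa using hy)
    _ ≤ ∫⁻ x, ∫⁻ y, ENNReal.ofReal κ⁻¹ * (G x y + G y x) :=
        (setLIntegral_le_lintegral _ _).trans
          (lintegral_mono fun x => setLIntegral_le_lintegral _ _)
    _ = ENNReal.ofReal κ⁻¹ * ((∫⁻ x, ∫⁻ y, G x y) + ∫⁻ x, ∫⁻ y, G y x) := by
        have h1 : ∀ x, ∫⁻ y, ENNReal.ofReal κ⁻¹ * (G x y + G y x) =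
            ENNReal.ofReal κ⁻¹ * ((∫⁻ y, G x y) + ∫⁻ y, G y x) := fun x => by
          rw [lintegral_const_mul _ ((hGm1 x).fun_add (hGm2 x)), lintegral_add_left (hGm1 x)]
        simp_rw [h1]
        have h2 : Measurable fun x => ∫⁻ y, G x y := hGm.lintegral_prod_right'
        have h3 : Measurable fun x => ∫⁻ y, G y x := hGm.lintegral_prod_left'
        rw [lintegral_const_mul _ (h2.fun_add h3), lintegral_add_left h2]
    _ ≤ _ := by
        have h4 : ∫⁻ x, ∫⁻ y, G y x = ∫⁻ x, ∫⁻ y, G x y :=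
          lintegral_lintegral_swap (hGm.comp measurable_swap).aemeasurable
        rw [h4]
        gcongr <;> exact hflux

/-- A ball centred in `B_2` meets `B_2` in a set containing a ball of half the radius. -/
theorem ball_smul_subset_ball_inter_ball {n : ℕ} {x : Rn n} {ρ : ℝ} (hx : ‖x‖ < 2)
    (hρ0 : 0 < ρ) (hρ : ρ ≤ 2) :
    ball ((1 - ρ / 4) • x) (ρ / 2) ⊆ ball 0 2 ∩ ball x ρ := by
  intro z hz
  rw [mem_ball, dist_eq_norm] at hz
  constructor
  · rw [mem_ball, dist_zero_right]
    have h1 : ‖z‖ ≤ ‖z - (1 - ρ / 4) • x‖ + ‖(1 - ρ / 4) • x‖ := norm_le_norm_sub_add _ _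
    rw [norm_smul, Real.norm_of_nonneg (by linarith)] at h1
    nlinarith
  · rw [mem_ball, dist_eq_norm]
    have h1 : ‖z - x‖ ≤ ‖z - (1 - ρ / 4) • x‖ + ‖(ρ / 4) • x‖ := by
      refine le_trans (le_of_eq ?_) (norm_sub_le _ _)
      congr 1
      module
    rw [norm_smul, Real.norm_of_nonneg (by linarith)] at h1
    nlinarith

/-- Decay of the level sets of a function with finite weighted fractional energy. -/
theorem volume_level_le {n : ℕ} {s p m t l : ℝ} (hn : 0 < n) (hs : 0 < s)
    (hp : 1 < p) (hm : m < p) (hsp : s * p < n) (ht : t = (p - m) * n / (n - s * p))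
    {M₁ M₂ : ℝ≥0∞} (hl : 1 ≤ l)
    (hl1 : M₁ ≤ ENNReal.ofReal (l ^ (p - 1) * (1 / 2 * (volume (ball (0 : Rn n) 1)).toReal)))
    (hl2 : M₂ ≤ ENNReal.ofReal (2 ^ (-p - ((n : ℝ) + s * p) - t) *
      (1 / 2 * (volume (ball (0 : Rn n) 1)).toReal) ^ 2 * l ^ (p - m)))
    {U : Rn n → ℝ} (hU : Measurable U)
    (h1 : ∫⁻ x in ball 0 2, ENNReal.ofReal (U x ^ (p - 1)) ≤ M₁)
    (h2 : ∫⁻ x in ball 0 2, ∫⁻ y in ball 0 2, ENNReal.ofReal (|U x - U y| ^ p *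
        (max (U x) (U y)) ^ (-m) * ‖x - y‖ ^ (-((n : ℝ) + s * p))) ≤ M₂) (j : ℕ) :
    volume (ball 0 2 ∩ {x | l * 2 ^ j ≤ U x}) ≤
      ENNReal.ofReal (1 / 2 * (volume (ball (0 : Rn n) 1)).toReal * 2 ^ (-(j * t))) := by
  set ω := (volume (ball (0 : Rn n) 1)).toReal with hω
  have hω0 : 0 < ω := ENNReal.toReal_pos (measure_ball_pos _ _ one_pos).ne' measure_ball_lt_top.ne
  have hA : ∀ a, MeasurableSet (ball 0 2 ∩ {x | a ≤ U x}) := fun a =>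
    measurableSet_ball.inter (measurableSet_le measurable_const hU)
  have hl0 : 0 < l := by linarith
  have hn0 : (0 : ℝ) < n := by exact_mod_cast hn
  have ht0 : 0 < t := by
    rw [ht]
    exact div_pos (mul_pos (by linarith) hn0) (by linarith)
  induction j with
  | zero =>
    have h3 : ENNReal.ofReal (l ^ (p - 1)) * volume (ball 0 2 ∩ {x | l ≤ U x}) ≤
        ENNReal.ofReal (l ^ (p - 1)) * ENNReal.ofReal (1 / 2 * ω) := by
      rw [← ENNReal.ofReal_mul (by positivity)]
      refine le_trans ?_ (h1.trans hl1)
      rw [← setLIntegral_const]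
      refine (setLIntegral_mono' (hA l) fun x hx => ?_).trans
        (lintegral_mono_set inter_subset_left)
      exact ENNReal.ofReal_le_ofReal (Real.rpow_le_rpow hl0.le hx.2 (by linarith))
    have h4 : ENNReal.ofReal (l ^ (p - 1)) ≠ 0 := by
      simpa using Real.rpow_pos_of_pos hl0 (p - 1)
    simpa using (ENNReal.mul_le_mul_iff_right h4 ENNReal.ofReal_ne_top).1 h3
  | succ j ih =>
    set e := (n : ℝ) + s * p with he
    have he0 : 0 < e := by positivity
    set b : ℝ := 2 ^ (-(j * t)) with hb
    have hb0 : 0 < b := by positivity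
    set ρ : ℝ := 2 * 2 ^ (-(j * t / n)) with hρ
    have hρ0 : 0 < ρ := by positivity
    have hρ2 : ρ ≤ 2 := by
      have : (2 : ℝ) ^ (-(j * t / n)) ≤ 1 :=
        Real.rpow_le_one_of_one_le_of_nonpos (by norm_num) (by
          rw [neg_nonpos]; positivity)
      linarith
    have hρn : (ρ / 2) ^ n = b := by
      rw [hρ, hb, mul_div_cancel_left₀ _ (two_ne_zero), ← Real.rpow_natCast,
        ← Real.rpow_mul (by norm_num)]
      congr 1
      field_simp
    set lj := l * 2 ^ j with hlj
    have hlj0 : 0 < lj := by positivity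
    set c := (2 : ℝ) ^ (-p) * lj ^ (p - m) * ρ ^ (-e) with hc
    have hc0 : 0 < c := by positivity
    have hcb : c * (1 / 2 * ω * b) * (1 / 2 * ω * 2 ^ (-((j + 1 : ℕ) * t))) =
        2 ^ (-p - e - t) * (1 / 2 * ω) ^ 2 * l ^ (p - m) := by
      have h5 : (2 : ℝ) ^ (-p) * (2 : ℝ) ^ (j * (p - m)) * ((2 : ℝ) ^ (-e) *
          (2 : ℝ) ^ (j * t / n * e)) * b * 2 ^ (-((j + 1 : ℕ) * t)) = 2 ^ (-p - e - t) := by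
        rw [hb, ← Real.rpow_add two_pos, ← Real.rpow_add two_pos, ← Real.rpow_add two_pos,
          ← Real.rpow_add two_pos, ← Real.rpow_add two_pos]
        congr 1
        have : t * (n - s * p) = (p - m) * n := by
          rw [ht, div_mul_cancel₀ _ (by linarith)]
        push_cast
        rw [he]
        field_simp
        linear_combination (-j : ℝ) * this
      have h6 : lj ^ (p - m) = l ^ (p - m) * 2 ^ (j * (p - m)) := by
        rw [hlj, Real.mul_rpow hl0.le (by positivity), Real.rpow_mul (by norm_num),
          Real.rpow_natCast]
      have h7 : ρ ^ (-e) = (2 : ℝ) ^ (-e) * (2 : ℝ) ^ (j * t / n * e) := by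
        rw [hρ, Real.mul_rpow (by norm_num) (by positivity), ← Real.rpow_mul (by norm_num)]
        congr 2
        ring
      rw [hc, h6, h7, ← h5]
      ring
    have hlevel : ENNReal.ofReal c * ENNReal.ofReal (1 / 2 * ω * b) *
        volume (ball 0 2 ∩ {x | l * 2 ^ (j + 1) ≤ U x}) ≤ M₂ := by
      refine le_trans ?_ h2
      rw [← lintegral_indicator measurableSet_ball]
      simp_rw [← lintegral_indicator measurableSet_ball]
      refine (mul_volume_le_lintegral_lintegral (hA (l * 2 ^ (j + 1)))
        (T := fun x => (ball 0 2 ∩ ball x ρ) \ (ball 0 2 ∩ {x | lj ≤ U x}))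
        (F := fun x y => (ball 0 2).indicator (fun x => (ball 0 2).indicator (fun y =>
          ENNReal.ofReal (|U x - U y| ^ p * (max (U x) (U y)) ^ (-m) * ‖x - y‖ ^ (-e))) y) x)
        (fun x _ => (measurableSet_ball.inter measurableSet_ball).diff (hA lj))
        (fun x hx => ?_) (fun x hx y hy => ?_)).trans (lintegral_mono fun x => ?_)
      · refine le_trans ?_ le_measure_sdiff
        have hx2 : ‖x‖ < 2 := by simpa using hx.1
        have h3 := measure_mono (μ := volume) (ball_smul_subset_ball_inter_ball hx2 hρ0 hρ2)
        rw [volume_ball_eq_ofReal _ (by positivity), hρn, ← hω] at h3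
        refine le_trans ?_ (tsub_le_tsub h3 ih)
        rw [← ENNReal.ofReal_sub _ (by positivity)]
        exact ENNReal.ofReal_le_ofReal (by linarith)
      · obtain ⟨⟨hy1, hy2⟩, hy3⟩ := hy
        rw [indicator_of_mem hx.1, indicator_of_mem hy1]
        apply ENNReal.ofReal_le_ofReal
        have hyU : U y < lj := by
          by_contra! h
          exact hy3 ⟨hy1, h⟩
        have hxU : 2 * lj ≤ U x := by
          have := hx.2
          simp only [mem_ofPred_eq] at this
          rw [hlj]
          calc _ = l * 2 ^ (j + 1) := by ring
            _ ≤ _ := this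
        have hxU0 : 0 < U x := by linarith
        have hne : x ≠ y := by
          rintro rfl
          linarith
        have h7 : 0 < ‖x - y‖ := norm_pos_iff.2 (sub_ne_zero.2 hne)
        rw [mem_ball, dist_comm, dist_eq_norm] at hy2
        rw [max_eq_left (by linarith), abs_of_nonneg (by linarith)]
        calc c ≤ 2 ^ (-p) * (U x) ^ (p - m) * ‖x - y‖ ^ (-e) := by
              have h8 : lj ^ (p - m) ≤ U x ^ (p - m) :=
                Real.rpow_le_rpow hlj0.le (by linarith) (by linarith)
              have h9 : ρ ^ (-e) ≤ ‖x - y‖ ^ (-e) :=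
                Real.rpow_le_rpow_of_nonpos h7 hy2.le (by linarith)
              rw [hc]
              gcongr
          _ = (U x / 2) ^ p * U x ^ (-m) * ‖x - y‖ ^ (-e) := by
              rw [Real.div_rpow hxU0.le (by norm_num), Real.rpow_neg (by norm_num),
                Real.rpow_sub hxU0, Real.rpow_neg hxU0.le]
              ring
          _ ≤ _ := by
              gcongr
              linarith
      · by_cases h : x ∈ ball (0 : Rn n) 2
        · simp only [indicator_of_mem h]
          exact le_rfl
        · simp [indicator_of_notMem h]
    have hpos : 0 < c * (1 / 2 * ω * b) := by positivity
    rw [← ENNReal.ofReal_mul hc0.le] at hlevel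
    have h8 := hlevel.trans hl2
    rw [← hcb, ENNReal.ofReal_mul hpos.le] at h8
    exact (ENNReal.mul_le_mul_iff_right (by simpa using hpos) ENNReal.ofReal_ne_top).1 h8

/-- Self-improved integrability for functions with finite weighted fractional energy. -/
theorem exists_lintegral_rpow_le_of_energy {n : ℕ} {s p m τ : ℝ} (hn : 0 < n) (hs : 0 < s)
    (hp : 1 < p) (hm : m < p) (hsp : s * p < n) (hτ0 : 0 ≤ τ)
    (hτ : τ < (p - m) * n / (n - s * p))
    {M₁ M₂ : ℝ≥0∞} (hM₁ : M₁ ≠ ⊤) (hM₂ : M₂ ≠ ⊤) :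
    ∃ M : ℝ≥0∞, M ≠ ⊤ ∧ ∀ U : Rn n → ℝ, Measurable U → (∀ x, 1 ≤ U x) →
      ∫⁻ x in ball 0 2, ENNReal.ofReal (U x ^ (p - 1)) ≤ M₁ →
      ∫⁻ x in ball 0 2, ∫⁻ y in ball 0 2, ENNReal.ofReal (|U x - U y| ^ p *
        (max (U x) (U y)) ^ (-m) * ‖x - y‖ ^ (-((n : ℝ) + s * p))) ≤ M₂ →
      ∫⁻ x in ball 0 2, ENNReal.ofReal (U x ^ τ) ≤ M := by
  set t := (p - m) * n / (n - s * p) with ht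
  set ω := (volume (ball (0 : Rn n) 1)).toReal with hω
  have hω0 : 0 < ω := ENNReal.toReal_pos (measure_ball_pos _ _ one_pos).ne' measure_ball_lt_top.ne
  set c₂ : ℝ := 2 ^ (-p - ((n : ℝ) + s * p) - t) * (1 / 2 * ω) ^ 2 with hc₂
  have hc₂0 : 0 < c₂ := by positivity
  obtain ⟨l, hl, hl1, hl2⟩ : ∃ l : ℝ, 1 ≤ l ∧ M₁.toReal ≤ l ^ (p - 1) * (1 / 2 * ω) ∧
      M₂.toReal ≤ c₂ * l ^ (p - m) := by
    have h1 := ((tendsto_rpow_atTop (by linarith : 0 < p - 1)).atTop_mul_const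
      (by positivity : 0 < 1 / 2 * ω)).eventually_ge_atTop M₁.toReal
    have h2 := ((tendsto_rpow_atTop (by linarith : 0 < p - m)).const_mul_atTop
      hc₂0).eventually_ge_atTop M₂.toReal
    obtain ⟨l, hl⟩ := ((eventually_ge_atTop (1 : ℝ)).and (h1.and h2)).exists
    exact ⟨l, hl.1, hl.2.1, hl.2.2⟩
  have hl0 : 0 < l := by linarith
  set g : ℕ → ℝ := fun j => (l * 2) ^ τ * (1 / 2 * ω) * ((2 : ℝ) ^ (τ - t)) ^ j with hg
  have hgs : Summable g := by
    refine (summable_geometric_of_lt_one (by positivity) ?_).mul_left _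
    exact Real.rpow_lt_one_of_one_lt_of_neg (by norm_num) (by linarith)
  refine ⟨ENNReal.ofReal (l ^ τ) * volume (ball (0 : Rn n) 2) + ∑' j, ENNReal.ofReal (g j),
    ENNReal.add_ne_top.2 ⟨ENNReal.mul_ne_top ENNReal.ofReal_ne_top measure_ball_lt_top.ne,
      hgs.tsum_ofReal_ne_top⟩, fun U hU hU1 h1 h2 => ?_⟩
  have hlev := volume_level_le hn hs hp hm hsp ht hl (M₁ := M₁) (M₂ := M₂)
    (ENNReal.le_ofReal_iff_toReal_le hM₁ (by positivity) |>.2 hl1)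
    (ENNReal.le_ofReal_iff_toReal_le hM₂ (by positivity) |>.2 hl2) hU h1 h2
  have hA : ∀ j : ℕ, MeasurableSet (ball 0 2 ∩ {x | l * 2 ^ j ≤ U x}) := fun a =>
    measurableSet_ball.inter (measurableSet_le measurable_const hU)
  calc ∫⁻ x in ball 0 2, ENNReal.ofReal (U x ^ τ)
      ≤ ∫⁻ x in ball 0 2, (ENNReal.ofReal (l ^ τ) + ∑' j : ℕ,
        (ball 0 2 ∩ {x | l * 2 ^ j ≤ U x}).indicator
          (fun _ => ENNReal.ofReal ((l * 2 ^ (j + 1)) ^ τ)) x) := by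
        refine setLIntegral_mono' measurableSet_ball fun x hx => ?_
        have hUx : 0 ≤ U x := by linarith [hU1 x]
        rcases le_or_gt (U x) l with h | h
        · refine le_trans ?_ le_self_add
          exact ENNReal.ofReal_le_ofReal (Real.rpow_le_rpow hUx h hτ0)
        · refine le_trans ?_ le_add_self
          obtain ⟨j, hj1, hj2⟩ := exists_nat_pow_near (x := U x / l) (y := 2)
            (by rw [le_div_iff₀ hl0]; linarith) (by norm_num)
          rw [le_div_iff₀ hl0] at hj1
          rw [div_lt_iff₀ hl0] at hj2
          refine le_trans ?_ (ENNReal.le_tsum j)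
          have hxj : x ∈ ball 0 2 ∩ {x | l * 2 ^ j ≤ U x} :=
            ⟨hx, by simpa [mul_comm] using hj1⟩
          rw [indicator_of_mem hxj]
          refine ENNReal.ofReal_le_ofReal (Real.rpow_le_rpow hUx ?_ hτ0)
          linarith
    _ = ENNReal.ofReal (l ^ τ) * volume (ball (0 : Rn n) 2) + ∑' j : ℕ,
        ENNReal.ofReal ((l * 2 ^ (j + 1)) ^ τ) * volume (ball 0 2 ∩ {x | l * 2 ^ j ≤ U x}) := by
        rw [lintegral_add_left measurable_const, setLIntegral_const, lintegral_tsum fun j =>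
          (measurable_const.indicator (hA j)).aemeasurable]
        congr 2
        ext j
        rw [setLIntegral_indicator (hA j), setLIntegral_const, inter_right_comm, inter_self]
    _ ≤ _ := by
        gcongr with j
        refine (mul_le_mul_right (hlev j) _).trans_eq ?_
        rw [← ENNReal.ofReal_mul (by positivity)]
        congr 1
        have h3 : (2 : ℝ) ^ (-(j * t)) = ((2 : ℝ) ^ (-t)) ^ j := by
          rw [← Real.rpow_natCast, ← Real.rpow_mul (by norm_num)]
          congr 1; ring
        have h4 : (l * 2 ^ (j + 1)) ^ τ = (l * 2) ^ τ * ((2 : ℝ) ^ τ) ^ j := by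
          rw [pow_succ, mul_comm ((2 : ℝ) ^ j), ← mul_assoc,
            Real.mul_rpow (by positivity) (by positivity), Real.rpow_pow_comm (by norm_num)]
        simp only [hg]
        rw [h3, h4, sub_eq_add_neg, Real.rpow_add two_pos, mul_pow]
        ring

/-- Weighted Young inequality for difference quotients. -/
theorem Real.rpow_div_rpow_le_add {n s p h q m A M d : ℝ} (hq : 0 < q) (hqp : q < p)
    (hA : 0 ≤ A) (hM : 0 < M) (hd : 0 < d) :
    A ^ q / d ^ (n + h * q) ≤ A ^ p * M ^ (-m) * d ^ (-(n + s * p)) +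
      M ^ (m * q / (p - q)) * d ^ (-n + (s - h) * q * p / (p - q)) := by
  have hp : 0 < p := by linarith
  have hpq : p - q ≠ 0 := by linarith
  set X := A ^ p * M ^ (-m) * d ^ (-(n + s * p)) with hX
  set Y := M ^ (m * q / (p - q)) * d ^ (-n + (s - h) * q * p / (p - q)) with hY
  have hX0 : 0 ≤ X := by positivity
  have hY0 : 0 ≤ Y := by positivity
  have h1 := Real.geom_mean_le_arith_mean2_weighted (w₁ := q / p) (w₂ := (p - q) / p)
    (by positivity) (div_nonneg (by linarith) hp.le) hX0 hY0 (by field_simp; ring)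
  have h2 : A ^ q / d ^ (n + h * q) = X ^ (q / p) * Y ^ ((p - q) / p) := by
    rw [hX, hY, Real.mul_rpow (by positivity) (by positivity),
      Real.mul_rpow (by positivity) (by positivity), Real.mul_rpow (by positivity) (by positivity),
      ← Real.rpow_mul hA, ← Real.rpow_mul hM.le, ← Real.rpow_mul hM.le, ← Real.rpow_mul hd.le,
      ← Real.rpow_mul hd.le]
    calc _ = A ^ q * d ^ (-(n + h * q)) := by rw [Real.rpow_neg hd.le, div_eq_mul_inv]
      _ = A ^ (p * (q / p)) * M ^ (-m * (q / p) + m * q / (p - q) * ((p - q) / p)) *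
        d ^ (-(n + s * p) * (q / p) + (-n + (s - h) * q * p / (p - q)) * ((p - q) / p)) := by
        have e1 : p * (q / p) = q := by field_simp
        have e2 : -m * (q / p) + m * q / (p - q) * ((p - q) / p) = 0 := by field_simp; ring
        have e3 : -(n + s * p) * (q / p) + (-n + (s - h) * q * p / (p - q)) * ((p - q) / p) =
            -(n + h * q) := by field_simp; ring
        rw [e1, e2, e3, Real.rpow_zero, mul_one]
      _ = _ := by rw [Real.rpow_add hM, Real.rpow_add hd]; ring
  have h3 : q / p ≤ 1 := (div_le_one hp).2 hqp.le
  have h4 : (p - q) / p ≤ 1 := (div_le_one hp).2 (by linarith)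
  rw [h2]
  nlinarith

theorem exists_exponent {n s p q : ℝ} (hsn : s < n) (hp : 1 < p)
    (hsp : s * p < n) (hqp : q < p) (hq : q < n * (p - 1) / (n - s)) :
    ∃ κ, 0 < κ ∧ κ + 1 < p ∧ (κ + 1) * q / (p - q) < (p - (κ + 1)) * n / (n - s * p) := by
  have h1 : (0 + 1) * q / (p - q) < (p - (0 + 1)) * n / (n - s * p) := by
    rw [lt_div_iff₀ (by linarith)] at hq
    rw [div_lt_div_iff₀ (by linarith) (by linarith)]
    nlinarith
  have h2 : ContinuousAt (fun κ : ℝ => (κ + 1) * q / (p - q)) 0 := by fun_prop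
  have h3 : ContinuousAt (fun κ : ℝ => (p - (κ + 1)) * n / (n - s * p)) 0 := by fun_prop
  have h4 := (h2.eventually_lt h3 h1).filter_mono (nhdsWithin_le_nhds (s := Ioi 0))
  have h5 : ∀ᶠ κ : ℝ in 𝓝[>] 0, κ < p - 1 :=
    (eventually_lt_nhds (by linarith)).filter_mono nhdsWithin_le_nhds
  obtain ⟨κ, hκ⟩ := (h4.and (h5.and self_mem_nhdsWithin)).exists
  exact ⟨κ, hκ.2.2, by linarith [hκ.2.1], hκ.1⟩

theorem lintegral_ball_two_sub_le {n : ℕ} {α : ℝ} {x : Rn n} (hx : ‖x‖ < 2) :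
    ∫⁻ y in ball (0 : Rn n) 2, ENNReal.ofReal (‖x - y‖ ^ α) ≤
      ∫⁻ z in ball (0 : Rn n) 4, ENNReal.ofReal (‖z‖ ^ α) := by
  rw [← lintegral_indicator measurableSet_ball, ← lintegral_indicator measurableSet_ball,
    ← lintegral_sub_left_eq_self
      ((ball (0 : Rn n) 4).indicator fun z => ENNReal.ofReal (‖z‖ ^ α)) x]
  refine lintegral_mono fun y => ?_
  by_cases hy : y ∈ ball (0 : Rn n) 2
  · have hy2 : x - y ∈ ball (0 : Rn n) 4 := by
      simp only [mem_ball, dist_zero_right] at hy ⊢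
      linarith [norm_sub_le x y]
    rw [indicator_of_mem hy, indicator_of_mem hy2]
  · rw [indicator_of_notMem hy]
    exact zero_le

set_option maxHeartbeats 1000000 in
/-- The gradient estimate on the unit scale for normalised supersolutions. -/
theorem exists_gagliardo_le {n : ℕ} {s p h q : ℝ} {C : ℝ≥0∞} (hn : 2 ≤ n) (hs : 0 < s)
    (hs1 : s < 1) (hp : 1 < p) (hsp : s * p < n) (hhs : h < s) (hq : 0 < q)
    (hqb : q < qBar n s p) (hC : C ≠ ⊤) :
    ∃ M : ℝ≥0∞, M ≠ ⊤ ∧ ∀ u : Rn n → ℝ, Measurable u → FluxIneq n s p C u →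
      (∀ x, ‖x‖ < 4 → 0 ≤ u x) → negTail n s p u ≤ 1 →
      (¬ ∀ᵐ x ∂volume.restrict (ball (0 : Rn n) 1), 1 ≤ u x) →
      ∫⁻ x in ball 0 2, ∫⁻ y in ball 0 2,
        ENNReal.ofReal (|u x - u y| ^ q / ‖x - y‖ ^ ((n : ℝ) + h * q)) ≤ M := by
  have hn0 : 0 < n := by linarith
  have hn2 : (2 : ℝ) ≤ n := by exact_mod_cast hn
  obtain ⟨hq1, hqp⟩ := lt_min_iff.1 hqb
  obtain ⟨κ, hκ0, hκp, hκ⟩ := exists_exponent (n := n) (by linarith) hp hsp hqp hq1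
  set m := κ + 1 with hm
  set τ := m * q / (p - q) with hτ
  have hτ0 : 0 ≤ τ := div_nonneg (by positivity) (by linarith)
  obtain ⟨M₁, hM₁, H₁⟩ := exists_lintegral_rpow_le hn0 hs hs1 hp hC
  obtain ⟨M₂, hM₂, H₂⟩ := exists_weighted_energy_le hn0 hs hs1 hp hκ0 (by linarith) hC
  obtain ⟨M₃, hM₃, H₃⟩ := exists_lintegral_rpow_le_of_energy hn0 hs hp hκp hsp hτ0 hκ hM₁ hM₂
  set α := -(n : ℝ) + (s - h) * q * p / (p - q) with hα
  have hαn : -(n : ℝ) < α := by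
    have : 0 < (s - h) * q * p / (p - q) :=
      div_pos (mul_pos (mul_pos (by linarith) hq) (by linarith)) (by linarith)
    linarith
  set J := ∫⁻ z in ball (0 : Rn n) 4, ENNReal.ofReal (‖z‖ ^ α) with hJ
  have hJt : J ≠ ⊤ := (lintegral_ball_rpow_norm_lt_top hn0 hαn 4).ne
  refine ⟨M₂ + (M₃ * J + M₃ * J), ENNReal.add_ne_top.2 ⟨hM₂, ENNReal.add_ne_top.2
    ⟨ENNReal.mul_ne_top hM₃ hJt, ENNReal.mul_ne_top hM₃ hJt⟩⟩, fun u hu hT hu4 htail hinf => ?_⟩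
  set U : Rn n → ℝ := fun x => 1 + max (u x) 0 with hU
  have hUm : Measurable U := by fun_prop
  have hU1 : ∀ x, 1 ≤ U x := fun x => by simp only [hU]; linarith [le_max_right (u x) 0]
  have hUu : ∀ x ∈ ball (0 : Rn n) 2, U x = 1 + u x := fun x hx => by
    simp only [hU]
    rw [max_eq_left (hu4 x (by simp only [mem_ball, dist_zero_right] at hx; linarith))]
  set E : Rn n → Rn n → ℝ≥0∞ := fun x y => ENNReal.ofReal (|u x - u y| ^ p *
    (1 + max (u x) (u y)) ^ (-m) * ‖x - y‖ ^ (-((n : ℝ) + s * p))) with hE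
  have hEm : Measurable (Function.uncurry E) := by
    simp only [hE, Function.uncurry_def]
    fun_prop
  have h2 : ∫⁻ x in ball 0 2, ∫⁻ y in ball 0 2, E x y ≤ M₂ := H₂ u hu hT hu4 htail hinf
  have h1 := H₁ u hu hT hu4 htail hinf
  have h3 : ∫⁻ x in ball 0 2, ENNReal.ofReal (U x ^ τ) ≤ M₃ := by
    refine H₃ U hUm hU1 ((lintegral_mono_set (ball_subset_ball (by norm_num))).trans h1) ?_
    refine le_trans (le_of_eq ?_) h2
    refine setLIntegral_congr_fun measurableSet_ball fun x hx =>
      setLIntegral_congr_fun measurableSet_ball fun y hy => ?_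
    simp only [hE]
    rw [hUu x hx, hUu y hy, add_sub_add_left_eq_sub, max_add_add_left]
  set G : Rn n → Rn n → ℝ≥0∞ := fun x y =>
    ENNReal.ofReal (U x ^ τ) * ENNReal.ofReal (‖x - y‖ ^ α) with hG
  have hGm : Measurable (Function.uncurry G) := by
    simp only [hG, Function.uncurry_def]
    fun_prop
  have h4 : ∫⁻ x in ball 0 2, ∫⁻ y in ball 0 2, G x y ≤ M₃ * J := by
    calc _ ≤ ∫⁻ x in ball 0 2, ENNReal.ofReal (U x ^ τ) * J := by
          refine setLIntegral_mono' measurableSet_ball fun x hx => ?_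
          simp only [hG]
          rw [lintegral_const_mul _ (by fun_prop)]
          gcongr
          exact lintegral_ball_two_sub_le (by simpa using hx)
      _ ≤ _ := by
          rw [lintegral_mul_const _ (by fun_prop)]
          gcongr
  have h5 : ∫⁻ x in ball 0 2, ∫⁻ y in ball 0 2, G y x ≤ M₃ * J := by
    refine (lintegral_lintegral_swap (f := fun x y => G y x)
      (hGm.comp measurable_swap).aemeasurable).trans_le h4
  calc _ ≤ ∫⁻ x in ball 0 2, ∫⁻ y in ball 0 2, (E x y + (G x y + G y x)) := by
        refine setLIntegral_mono' measurableSet_ball fun x hx =>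
          setLIntegral_mono' measurableSet_ball fun y hy => ?_
        rcases eq_or_ne x y with rfl | hne
        · simp [Real.zero_rpow hq.ne']
        have h7 : 0 < ‖x - y‖ := norm_pos_iff.2 (sub_ne_zero.2 hne)
        have hux : 0 ≤ u x := hu4 x (by simp only [mem_ball, dist_zero_right] at hx; linarith)
        have hmax : 0 < 1 + max (u x) (u y) := by linarith [le_max_left (u x) (u y)]
        have hUx := hU1 x
        have hUy := hU1 y
        have hUxτ : 0 ≤ U x ^ τ := Real.rpow_nonneg (by linarith) _
        have hUyτ : 0 ≤ U y ^ τ := Real.rpow_nonneg (by linarith) _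
        have hy1 := Real.rpow_div_rpow_le_add (n := n) (s := s) (h := h) (m := m) hq hqp
          (abs_nonneg (u x - u y)) hmax h7
        rw [← hτ, ← hα] at hy1
        have hdα : 0 ≤ ‖x - y‖ ^ α := by positivity
        have h8 : (1 + max (u x) (u y)) ^ τ ≤ U x ^ τ + U y ^ τ := by
          rw [← max_add_add_left, ← hUu x hx, ← hUu y hy]
          rcases max_choice (U x) (U y) with h | h <;> rw [h] <;> linarith
        simp only [hE, hG]
        rw [norm_sub_rev y x, ← ENNReal.ofReal_mul hUxτ, ← ENNReal.ofReal_mul hUyτ,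
          ← ENNReal.ofReal_add (by positivity) (by positivity),
          ← ENNReal.ofReal_add (by positivity) (by positivity)]
        apply ENNReal.ofReal_le_ofReal
        nlinarith
    _ = (∫⁻ x in ball 0 2, ∫⁻ y in ball 0 2, E x y) + ((∫⁻ x in ball 0 2, ∫⁻ y in ball 0 2, G x y) +
          ∫⁻ x in ball 0 2, ∫⁻ y in ball 0 2, G y x) := by
        clear_value E G
        have hE1 : ∀ x, Measurable (E x) := fun x => hEm.comp measurable_prodMk_left
        have hG1 : ∀ x, Measurable (G x) := fun x => hGm.comp measurable_prodMk_left
        have hE2 : Measurable fun x => ∫⁻ y in ball 0 2, E x y := hEm.lintegral_prod_right'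
        have hG2 : Measurable fun x => ∫⁻ y in ball 0 2, G x y := hGm.lintegral_prod_right'
        rw [← lintegral_add_left hG2, ← lintegral_add_left hE2]
        refine lintegral_congr fun x => ?_
        rw [lintegral_add_left (hE1 x), lintegral_add_left (hG1 x)]
    _ ≤ _ := add_le_add h2 (add_le_add h4 h5)

section Translation

variable {W : Type*} [NormedAddCommGroup W] [MeasurableSpace W] [BorelSpace W]
  [SecondCountableTopology W] {ν : Measure W} [ν.IsAddRightInvariant] {P Q : ℝ≥0∞}
  {F G : W → ℝ}

/-- The pairing of an `L^Q` function with the translates of an `L^P` function is continuous. -/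
theorem continuous_integral_mul_comp_sub [LocallyCompactSpace W]
    [IsLocallyFiniteMeasure ν] [hPQ : ENNReal.HolderConjugate P Q]
    (hP : P ≠ ⊤) (hF : MemLp F P ν) (hG : MemLp G Q ν) :
    Continuous fun v : W => ∫ w, G w * F (w - v) ∂ν := by
  have : Fact (1 ≤ P) := ⟨ENNReal.HolderConjugate.one_le P Q⟩
  have : Fact (1 ≤ Q) := ⟨ENNReal.HolderConjugate.one_le Q P⟩
  let τ : C(W, C(W, W)) := ContinuousMap.curry ⟨fun q : W × W => q.2 - q.1, by fun_prop⟩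
  have hτ : ∀ v, MeasurePreserving (τ v) ν ν := fun v => measurePreserving_sub_right ν v
  have h1 : Continuous fun v => Lp.compMeasurePreserving (τ v) (hτ v) (hF.toLp F) :=
    continuous_const.compMeasurePreservingLp τ.continuous hτ hP
  have h2 : Continuous fun v => (ContinuousLinearMap.mul ℝ ℝ).lpPairing ν Q P (hG.toLp G)
      (Lp.compMeasurePreserving (τ v) (hτ v) (hF.toLp F)) :=
    (ContinuousLinearMap.continuous _).comp h1
  refine h2.congr fun v => ?_
  rw [ContinuousLinearMap.lpPairing_eq_integral]
  refine integral_congr_ae ?_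
  rw [Lp.toLp_compMeasurePreserving hF (hτ v)]
  filter_upwards [hG.coeFn_toLp, (hF.comp_measurePreserving (hτ v)).coeFn_toLp] with w h3 h4
  rw [h3, h4]
  rfl

theorem integrable_mul_comp_sub {Z : Type*} [MeasurableSpace Z] {ζ : Measure Z} [SFinite ζ]
    [SFinite ν] [hPQ : ENNReal.HolderConjugate P Q] (hFm : Measurable F) (hGm : Measurable G)
    (hF : MemLp F P ν) (hG : MemLp G Q ν)
    {ρ : Z → ℝ} (hρ : Integrable ρ ζ) (hρm : Measurable ρ) {T : Z → W} (hT : Measurable T) :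
    Integrable (fun q : Z × W => ρ q.1 * (G q.2 * F (q.2 - T q.1))) (ζ.prod ν) := by
  have hm : Measurable fun q : Z × W => ρ q.1 * (G q.2 * F (q.2 - T q.1)) := by fun_prop
  have hF' : ∀ v, MemLp (fun w => F (w - v)) P ν := fun v =>
    hF.comp_measurePreserving (measurePreserving_sub_right ν v)
  refine ⟨hm.aestronglyMeasurable, ?_⟩
  rw [HasFiniteIntegral, lintegral_prod _ hm.enorm.aemeasurable]
  have h1 : ∀ z, ∫⁻ w, ‖ρ z * (G w * F (w - T z))‖ₑ ∂ν ≤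
      ‖ρ z‖ₑ * (eLpNorm G Q ν * eLpNorm F P ν) := by
    intro z
    have h2 : ∫⁻ w, ‖G w * F (w - T z)‖ₑ ∂ν ≤ eLpNorm G Q ν * eLpNorm F P ν := by
      have h3 := eLpNorm_smul_le_mul_eLpNorm (p := Q) (q := P) (r := 1)
        (hF' (T z)).aestronglyMeasurable hG.aestronglyMeasurable
      have h4 : eLpNorm (fun w => F (w - T z)) P ν = eLpNorm F P ν :=
        eLpNorm_comp_measurePreserving hF.aestronglyMeasurable
          (measurePreserving_sub_right ν (T z))
      rw [h4, eLpNorm_one_eq_lintegral_enorm] at h3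
      exact h3
    calc _ = ‖ρ z‖ₑ * ∫⁻ w, ‖G w * F (w - T z)‖ₑ ∂ν := by
          simp_rw [enorm_mul (ρ z)]
          exact lintegral_const_mul _ (by fun_prop)
      _ ≤ _ := by gcongr
  calc _ ≤ ∫⁻ z, ‖ρ z‖ₑ * (eLpNorm G Q ν * eLpNorm F P ν) ∂ζ := lintegral_mono h1
    _ = (∫⁻ z, ‖ρ z‖ₑ ∂ζ) * (eLpNorm G Q ν * eLpNorm F P ν) :=
        lintegral_mul_const _ hρm.enorm
    _ < ⊤ := ENNReal.mul_lt_top hρ.2 (ENNReal.mul_lt_top hG.eLpNorm_lt_top hF.eLpNorm_lt_top)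

end Translation

/-- Nonnegativity of a translation-continuous form on nonnegative smooth test functions extends to
bounded measurable test functions. -/
theorem integral_prod_nonneg_of_test {n : ℕ} {P Q : ℝ≥0∞} [hPQ : ENNReal.HolderConjugate P Q]
    (hP : P ≠ ⊤) {F G a : Rn n × Rn n → ℝ} {φ : Rn n → ℝ} {B : ℝ} {x₀ : Rn n} {r : ℝ} (hr : 0 < r)
    (hFm : Measurable F) (hGm : Measurable G) (hF : MemLp F P) (hG : MemLp G Q)
    (hφm : Measurable φ) (hφ0 : ∀ x, 0 ≤ φ x) (hφB : ∀ x, φ x ≤ B)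
    (hφs : ∀ x, 3 * r ≤ ‖x - x₀‖ → φ x = 0)
    (haFG : ∀ w z, G w * F (w - (z, z)) = a w * (φ (w.1 - z) - φ (w.2 - z)))
    (htest : ∀ ψ : Rn n → ℝ, IsTestFun n (ball x₀ (4 * r)) ψ → (∀ x, 0 ≤ ψ x) →
      0 ≤ ∫ x, ∫ y, a (x, y) * (ψ x - ψ y)) :
    0 ≤ ∫ w : Rn n × Rn n, a w * (φ w.1 - φ w.2) := by
  have : (volume : Measure (Rn n × Rn n)).IsAddRightInvariant :=
    inferInstanceAs (((volume : Measure (Rn n)).prod volume).IsAddRightInvariant)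
  set J : Rn n → ℝ := fun z => ∫ w : Rn n × Rn n, G w * F (w - (z, z)) with hJ
  have hJc : Continuous J :=
    (continuous_integral_mul_comp_sub hP hF hG).comp
      (by fun_prop : Continuous fun z : Rn n => (z, z))
  have hJ0 : ∫ w : Rn n × Rn n, a w * (φ w.1 - φ w.2) = J 0 := by
    rw [hJ]
    refine integral_congr_ae (.of_forall fun w => ?_)
    simp only [haFG, sub_zero]
  rw [hJ0]
  by_contra! hneg
  obtain ⟨ε, hε, hεJ⟩ : ∃ ε > 0, ∀ z, ‖z‖ < ε → J z < J 0 / 2 := by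
    have h1 : ∀ᶠ z in 𝓝 (0 : Rn n), J z < J 0 / 2 :=
      hJc.continuousAt.eventually_lt_const (by linarith)
    obtain ⟨ε, hε, h⟩ := Metric.eventually_nhds_iff.1 h1
    exact ⟨ε, hε, fun z hz => h (by simpa using hz)⟩
  set δ := min ε (r / 2) with hδ
  have hδ0 : 0 < δ := lt_min hε (by linarith)
  let f : ContDiffBump (0 : Rn n) := ⟨δ / 2, δ, by linarith, by linarith⟩
  set ρ : Rn n → ℝ := f.normed volume with hρ
  have hρc : Continuous ρ := f.continuous_normed
  have hρs : HasCompactSupport ρ := f.hasCompactSupport_normed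
  have hρ0 : ∀ x, 0 ≤ ρ x := fun x => f.nonneg_normed x
  have hρi : Integrable ρ := f.integrable_normed
  have hρz : ∀ z, δ ≤ ‖z‖ → ρ z = 0 := by
    intro z hz
    by_contra h
    have : z ∈ Function.support (f.normed volume) := h
    rw [f.support_normed_eq] at this
    simp at this
    exact absurd this (not_lt.2 hz)
  have hconv : ∀ x, Integrable fun z => ρ z * φ (x - z) := fun x =>
    hρi.mul_bdd (c := B) (by fun_prop : Measurable fun z => φ (x - z)).aestronglyMeasurable
      (.of_forall fun z => by rw [Real.norm_of_nonneg (hφ0 _)]; exact hφB _)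
  set ψ : Rn n → ℝ := fun x => ∫ z, ρ z * φ (x - z) with hψ
  have hφloc : LocallyIntegrable φ := by
    refine (locallyIntegrable_const B).mono hφm.aestronglyMeasurable (.of_forall fun x => ?_)
    rw [Real.norm_of_nonneg (hφ0 _)]
    exact (hφB _).trans (le_abs_self _)
  have hψsub : Function.support ψ ⊆ closedBall x₀ (7 / 2 * r) := by
    intro x hx
    by_contra h
    refine hx ?_
    rw [hψ]
    beta_reduce
    refine integral_eq_zero_of_ae (.of_forall fun z => ?_)
    rcases le_or_gt δ ‖z‖ with hz | hz
    · simp [hρz z hz]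
    · have h3 : δ ≤ r / 2 := min_le_right _ _
      rw [mem_closedBall, dist_eq_norm, not_le] at h
      have h4 := norm_sub_norm_le (x - x₀) z
      simp only [hφs (x - z) (by rw [sub_right_comm]; linarith), mul_zero, Pi.zero_apply]
  have hψt : IsTestFun n (ball x₀ (4 * r)) ψ := by
    refine ⟨?_, HasCompactSupport.of_support_subset_isCompact
      (isCompact_closedBall x₀ (7 / 2 * r)) hψsub,
      (closure_minimal hψsub isClosed_closedBall).trans (closedBall_subset_ball (by linarith))⟩
    have := hρs.contDiff_convolution_left (ContinuousLinearMap.mul ℝ ℝ) (n := (⊤ : ℕ∞))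
      f.contDiff_normed hφloc (μ := volume)
    exact this
  have hψ0 : ∀ x, 0 ≤ ψ x := fun x => integral_nonneg fun z => mul_nonneg (hρ0 z) (hφ0 _)
  have hI : Integrable (fun q : Rn n × (Rn n × Rn n) => ρ q.1 * (G q.2 * F (q.2 - (q.1, q.1)))) :=
    integrable_mul_comp_sub (T := fun z : Rn n => (z, z)) hFm hGm hF hG hρi hρc.measurable
      (by fun_prop)
  have hkey : ∫ x, ∫ y, a (x, y) * (ψ x - ψ y) = ∫ z, ρ z * J z := by
    have h1 : ∀ w : Rn n × Rn n, a w * (ψ w.1 - ψ w.2) =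
        ∫ z, ρ z * (G w * F (w - (z, z))) := by
      intro w
      rw [hψ]
      beta_reduce
      rw [← integral_sub (hconv _) (hconv _), ← integral_const_mul]
      refine integral_congr_ae (.of_forall fun z => ?_)
      simp only [haFG]
      ring
    have h2 := hI.integral_prod_right
    calc _ = ∫ x, ∫ y, ∫ z, ρ z * (G (x, y) * F ((x, y) - (z, z))) := by
          simp_rw [← h1]
      _ = ∫ w : Rn n × Rn n, ∫ z, ρ z * (G w * F (w - (z, z))) :=
          (integral_prod _ h2).symm
      _ = ∫ z, ∫ w : Rn n × Rn n, ρ z * (G w * F (w - (z, z))) :=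
          (integral_integral_swap hI).symm
      _ = _ := by simp_rw [integral_const_mul, hJ]
  have h3 := htest ψ hψt hψ0
  rw [hkey] at h3
  have h4 : ∫ z, ρ z * J z ≤ ∫ z, ρ z * (J 0 / 2) := by
    refine integral_mono ?_ (hρi.mul_const _) fun z => ?_
    · have := hI.integral_prod_left
      refine this.congr (.of_forall fun z => ?_)
      simp only [integral_const_mul, hJ]
    · beta_reduce
      rcases le_or_gt δ ‖z‖ with hz | hz
      · simp [hρz z hz]
      · exact mul_le_mul_of_nonneg_left (hεJ z (hz.trans_le (min_le_left _ _))).le (hρ0 z)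
  rw [integral_mul_const, hρ, f.integral_normed] at h4
  linarith

section Structure

variable {n : ℕ} {Λ s p : ℝ} {Φ : ℝ → ℝ} {K : Rn n → Rn n → ℝ}

theorem PhiBounds.abs_le (hΦ : PhiBounds Λ p Φ) (hΛ : 1 ≤ Λ) (t : ℝ) :
    |Φ t| ≤ Λ * |t| ^ (p - 1) := by
  rcases eq_or_ne t 0 with rfl | ht
  · rw [hΦ.2.1, abs_zero]
    positivity
  · have h := hΦ.2.2 t
    have ht' := abs_pos.2 ht
    have h0 : 0 ≤ Φ t * t := le_trans (by positivity) h.1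
    refine le_of_mul_le_mul_right ?_ ht'
    rw [← abs_mul, abs_of_nonneg h0, mul_assoc, ← Real.rpow_add_one ht'.ne', sub_add_cancel]
    exact h.2

theorem PhiBounds.le_of_pos (hΦ : PhiBounds Λ p Φ) {t : ℝ} (ht : 0 < t) :
    t ^ (p - 1) / Λ ≤ Φ t := by
  have h := (hΦ.2.2 t).1
  rw [abs_of_pos ht] at h
  refine le_of_mul_le_mul_right ?_ ht
  rwa [div_mul_eq_mul_div, ← Real.rpow_add_one ht.ne', sub_add_cancel]

theorem PhiBounds.le_neg_of_neg (hΦ : PhiBounds Λ p Φ) {t : ℝ} (ht : t < 0) :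
    (-t) ^ (p - 1) / Λ ≤ -Φ t := by
  have h := (hΦ.2.2 t).1
  rw [abs_of_neg ht] at h
  refine le_of_mul_le_mul_right ?_ (neg_pos.2 ht)
  rwa [div_mul_eq_mul_div, ← Real.rpow_add_one (neg_pos.2 ht).ne', sub_add_cancel, neg_mul_neg]

theorem KernelBounds.le (hK : KernelBounds n Λ s p K) {x y : Rn n} (h : x ≠ y) :
    K x y ≤ Λ * ‖x - y‖ ^ (-((n : ℝ) + s * p)) := by
  rw [Real.rpow_neg (norm_nonneg _), ← div_eq_mul_inv]
  exact (hK.2 x y h).2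

theorem KernelBounds.le' (hK : KernelBounds n Λ s p K) {x y : Rn n} (h : x ≠ y) :
    ‖x - y‖ ^ (-((n : ℝ) + s * p)) / Λ ≤ K x y := by
  refine le_trans (le_of_eq ?_) (hK.2 x y h).1
  rw [Real.rpow_neg (norm_nonneg _), one_div, mul_inv, div_eq_mul_inv, mul_comm]

end Structure

theorem memLp_ofReal_iff {α : Type*} [MeasurableSpace α] {ν : Measure α} {p : ℝ} (hp : 0 < p)
    {f : α → ℝ} (hf : Measurable f) :
    MemLp f (ENNReal.ofReal p) ν ↔ ∫⁻ a, ENNReal.ofReal (|f a| ^ p) ∂ν < ⊤ := by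
  rw [MemLp, eLpNorm_lt_top_iff_lintegral_rpow_enorm_lt_top (by simpa using hp)
    ENNReal.ofReal_ne_top, ENNReal.toReal_ofReal hp.le]
  simp_rw [Real.enorm_eq_ofReal_abs, ENNReal.ofReal_rpow_of_nonneg (abs_nonneg _) hp.le]
  exact and_iff_right hf.aestronglyMeasurable

/-- The difference quotient with the exponent making its `L^p` norm the Gagliardo seminorm. -/
def diffQuot (n : ℕ) (s p : ℝ) (v : Rn n → ℝ) (w : Rn n × Rn n) : ℝ :=
  (v w.1 - v w.2) * ‖w.1 - w.2‖ ^ (-(((n : ℝ) + s * p) / p))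

theorem measurable_diffQuot {n : ℕ} {s p : ℝ} {v : Rn n → ℝ} (hv : Measurable v) :
    Measurable (diffQuot n s p v) := by
  unfold diffQuot; fun_prop

theorem rpow_neg_div_rpow {d e p : ℝ} (hd : 0 ≤ d) (hp : 0 < p) :
    (d ^ (-(e / p))) ^ p = d ^ (-e) := by
  rw [← Real.rpow_mul hd]
  congr 1
  field_simp

theorem memLp_diffQuot {n : ℕ} {s p : ℝ} (hp : 0 < p) {u : Rn n → ℝ} (hu : Measurable u)
    (hE : gagliardo n s p univ u < ⊤) : MemLp (diffQuot n s p u) (ENNReal.ofReal p) := by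
  rw [memLp_ofReal_iff hp (measurable_diffQuot hu), Measure.volume_eq_prod,
    lintegral_prod _ (by have := measurable_diffQuot (s := s) (p := p) hu; fun_prop)]
  refine lt_of_le_of_lt (le_of_eq ?_) hE
  rw [gagliardo, setLIntegral_univ]
  refine lintegral_congr fun x => ?_
  rw [setLIntegral_univ]
  refine lintegral_congr fun y => ?_
  rw [diffQuot, abs_mul, Real.mul_rpow (abs_nonneg _) (abs_nonneg _),
    abs_of_nonneg (Real.rpow_nonneg (norm_nonneg _) _), rpow_neg_div_rpow (norm_nonneg _) hp,
    Real.rpow_neg (norm_nonneg _), div_eq_mul_inv]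

theorem memLp_indicator_mul_min_kernel {n : ℕ} {s p : ℝ} (hn : 0 < n) (hs : 0 < s) (hs1 : s < 1)
    (hp : 1 < p) (x₀ : Rn n) (R : ℝ) :
    MemLp (fun w : Rn n × Rn n => (ball x₀ R).indicator (fun _ => (1 : ℝ)) w.1 *
      (min 1 ‖w.1 - w.2‖ * ‖w.1 - w.2‖ ^ (-(((n : ℝ) + s * p) / p)))) (ENNReal.ofReal p) := by
  have hp0 : 0 < p := by linarith
  have hi : Measurable ((ball x₀ R).indicator (fun _ => (1 : ℝ))) :=
    measurable_const.indicator measurableSet_ball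
  have hm : Measurable (fun w : Rn n × Rn n => (ball x₀ R).indicator (fun _ => (1 : ℝ)) w.1 *
      (min 1 ‖w.1 - w.2‖ * ‖w.1 - w.2‖ ^ (-(((n : ℝ) + s * p) / p)))) := by fun_prop
  rw [memLp_ofReal_iff hp0 hm, Measure.volume_eq_prod, lintegral_prod _ (by fun_prop)]
  have h1 : ∀ x, ∫⁻ y, ENNReal.ofReal (|(ball x₀ R).indicator (fun _ => (1 : ℝ)) x *
      (min 1 ‖x - y‖ * ‖x - y‖ ^ (-(((n : ℝ) + s * p) / p)))| ^ p) =
      (ball x₀ R).indicator (fun _ => ∫⁻ z : Rn n, ENNReal.ofReal ((min 1 ‖z‖) ^ p *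
        ‖z‖ ^ (-((n : ℝ) + s * p)))) x := by
    intro x
    by_cases hx : x ∈ ball x₀ R
    · rw [indicator_of_mem hx, indicator_of_mem hx,
        ← lintegral_sub_left_eq_self (fun z : Rn n => ENNReal.ofReal ((min 1 ‖z‖) ^ p *
        ‖z‖ ^ (-((n : ℝ) + s * p)))) x]
      refine lintegral_congr fun y => ?_
      have hM : 0 ≤ min 1 ‖x - y‖ := le_min zero_le_one (norm_nonneg _)
      have hk := Real.rpow_nonneg (norm_nonneg (x - y)) (-(((n : ℝ) + s * p) / p))
      rw [one_mul, abs_of_nonneg (mul_nonneg hM hk), Real.mul_rpow hM hk,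
        rpow_neg_div_rpow (norm_nonneg _) hp0]
    · rw [indicator_of_notMem hx, indicator_of_notMem hx]
      simp [hp0.ne']
  simp_rw [h1]
  rw [lintegral_indicator measurableSet_ball, setLIntegral_const]
  exact ENNReal.mul_lt_top (lintegral_min_rpow_mul_kernel_lt_top hn hs hs1 hp)
    measure_ball_lt_top

theorem memLp_diffQuot_of_abs_sub_le {n : ℕ} {s p : ℝ} (hn : 0 < n) (hs : 0 < s) (hs1 : s < 1)
    (hp : 1 < p) {u φ : Rn n → ℝ} (hu : Measurable u) (hE : gagliardo n s p univ u < ⊤)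
    (hφm : Measurable φ) (hφ0 : ∀ x, 0 ≤ φ x) {B L R : ℝ} (hφB : ∀ x, φ x ≤ B) {x₀ : Rn n}
    (hφs : ∀ x, R ≤ ‖x - x₀‖ → φ x = 0)
    (hL : ∀ x y, |φ x - φ y| ≤ L * (|u x - u y| + ‖x - y‖)) :
    MemLp (diffQuot n s p φ) (ENNReal.ofReal p) := by
  set H : Rn n × Rn n → ℝ := fun w => (ball x₀ R).indicator (fun _ => (1 : ℝ)) w.1 *
      (min 1 ‖w.1 - w.2‖ * ‖w.1 - w.2‖ ^ (-(((n : ℝ) + s * p) / p))) with hH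
  have hH1 : MemLp H (ENNReal.ofReal p) := memLp_indicator_mul_min_kernel hn hs hs1 hp x₀ R
  have hH2 : MemLp (H ∘ Prod.swap) (ENNReal.ofReal p) :=
    hH1.comp_measurePreserving Measure.measurePreserving_swap
  have hU := memLp_diffQuot (by linarith) hu hE
  have hB : 0 ≤ B := (hφ0 0).trans (hφB 0)
  have hsum := ((hU.norm.const_mul |L|).add (hH1.const_mul (B + |L|))).add
    (hH2.const_mul (B + |L|))
  refine hsum.mono (measurable_diffQuot hφm).aestronglyMeasurable (.of_forall fun w => ?_)
  obtain ⟨x, y⟩ := w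
  refine le_trans ?_ (le_abs_self _)
  simp only [diffQuot, Pi.add_apply, hH, Function.comp, Prod.swap, Real.norm_eq_abs, abs_mul]
  rw [norm_sub_rev y x]
  set k := ‖x - y‖ ^ (-(((n : ℝ) + s * p) / p))
  have hk : 0 ≤ k := Real.rpow_nonneg (norm_nonneg _) _
  rw [abs_of_nonneg hk]
  set ix := (ball x₀ R).indicator (fun _ => (1 : ℝ)) x with hix
  set iy := (ball x₀ R).indicator (fun _ => (1 : ℝ)) y with hiy
  set M := min 1 ‖x - y‖ with hM
  have hM0 : 0 ≤ M := le_min zero_le_one (norm_nonneg _)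
  have hix0 : 0 ≤ ix := indicator_nonneg (fun _ _ => zero_le_one) _
  have hiy0 : 0 ≤ iy := indicator_nonneg (fun _ _ => zero_le_one) _
  have key : |φ x - φ y| ≤ |L| * |u x - u y| + (B + |L|) * M * (ix + iy) := by
    by_cases hxy : φ x = 0 ∧ φ y = 0
    · rw [hxy.1, hxy.2, sub_zero, abs_zero]
      positivity
    · have hi : 1 ≤ ix + iy := by
        rw [not_and_or] at hxy
        rcases hxy with h | h
        · have : x ∈ ball x₀ R := by
            by_contra h'
            exact h (hφs x (by simpa [dist_eq_norm] using h'))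
          rw [hix, indicator_of_mem this]; linarith
        · have : y ∈ ball x₀ R := by
            by_contra h'
            exact h (hφs y (by simpa [dist_eq_norm] using h'))
          rw [hiy, indicator_of_mem this]; linarith
      refine le_trans ?_ (add_le_add_right (le_mul_of_one_le_right (by positivity) hi) _)
      have hLa := abs_nonneg L
      rcases le_total 1 ‖x - y‖ with h1 | h1
      · rw [hM, min_eq_left h1]
        have : |φ x - φ y| ≤ B := by
          rw [_root_.abs_le]
          constructor <;> linarith [hφ0 x, hφ0 y, hφB x, hφB y]
        nlinarith [abs_nonneg (u x - u y), mul_nonneg hLa (abs_nonneg (u x - u y))]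
      · rw [hM, min_eq_right h1]
        have h2 : L * (|u x - u y| + ‖x - y‖) ≤ |L| * (|u x - u y| + ‖x - y‖) := by
          gcongr
          exact le_abs_self L
        nlinarith [hL x y, mul_nonneg hB (norm_nonneg (x - y))]
  calc _ ≤ (|L| * |u x - u y| + (B + |L|) * M * (ix + iy)) * k := by gcongr
    _ = _ := by ring

section FluxDensity

variable {n : ℕ} {Λ s p : ℝ} {Φ : ℝ → ℝ} {K : Rn n → Rn n → ℝ} {u φ : Rn n → ℝ}

theorem upFlux_density_le (hK : KernelBounds n Λ s p K) (hΦ : PhiBounds Λ p Φ) (hΛ : 1 ≤ Λ)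
    (hp : 1 < p) (x y : Rn n) :
    ENNReal.ofReal (max (u y - u x) 0 ^ (p - 1) * max (φ x - φ y) 0 *
      ‖x - y‖ ^ (-((n : ℝ) + s * p))) ≤
      ENNReal.ofReal (Λ ^ 2) * ENNReal.ofReal (-(Φ (u x - u y) * K x y * (φ x - φ y))) := by
  rw [← ENNReal.ofReal_mul (by positivity)]
  rcases le_or_gt (u y) (u x) with h1 | h1
  · rw [max_eq_right (by linarith : u y - u x ≤ 0), Real.zero_rpow (by linarith)]
    simp
  rcases le_or_gt (φ x) (φ y) with h2 | h2
  · rw [max_eq_right (by linarith : φ x - φ y ≤ 0)]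
    simp
  refine ENNReal.ofReal_le_ofReal ?_
  rw [max_eq_left (by linarith : 0 ≤ u y - u x), max_eq_left (by linarith : 0 ≤ φ x - φ y)]
  have hxy : x ≠ y := by rintro rfl; exact lt_irrefl _ h1
  have h3 := hΦ.le_neg_of_neg (by linarith : u x - u y < 0)
  rw [neg_sub] at h3
  have h4 := hK.le' hxy
  have h5 : 0 ≤ (u y - u x) ^ (p - 1) := Real.rpow_nonneg (by linarith) _
  have h6 : 0 ≤ ‖x - y‖ ^ (-((n : ℝ) + s * p)) := Real.rpow_nonneg (norm_nonneg _) _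
  have h7 : 0 ≤ φ x - φ y := by linarith
  have h8 : 0 ≤ (u y - u x) ^ (p - 1) / Λ := by positivity
  calc _ = Λ ^ 2 * ((u y - u x) ^ (p - 1) / Λ * (‖x - y‖ ^ (-((n : ℝ) + s * p)) / Λ) *
        (φ x - φ y)) := by field_simp
    _ ≤ Λ ^ 2 * (-Φ (u x - u y) * K x y * (φ x - φ y)) := by
        gcongr
        exact h8.trans h3
    _ = _ := by ring

theorem form_density_le (hK : KernelBounds n Λ s p K) (hΦ : PhiBounds Λ p Φ) (hΛ : 1 ≤ Λ)
    (x y : Rn n) :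
    ENNReal.ofReal (Φ (u x - u y) * K x y * (φ x - φ y)) ≤
      ENNReal.ofReal (Λ ^ 2) *
        (ENNReal.ofReal (max (u y - u x) 0 ^ (p - 1) * max (-φ x - -φ y) 0 *
          ‖x - y‖ ^ (-((n : ℝ) + s * p))) +
        ENNReal.ofReal (max (u x - u y) 0 ^ (p - 1) * max (-φ y - -φ x) 0 *
          ‖y - x‖ ^ (-((n : ℝ) + s * p)))) := by
  rcases eq_or_ne x y with rfl | hxy
  · simp
  rw [norm_sub_rev y x]
  have h4 := hK.le hxy
  have hk0 : 0 ≤ K x y := le_trans (by positivity) (hK.le' hxy)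
  have h6 : 0 ≤ ‖x - y‖ ^ (-((n : ℝ) + s * p)) := Real.rpow_nonneg (norm_nonneg _) _
  have h5 := hΦ.abs_le hΛ (u x - u y)
  have main : |Φ (u x - u y)| * K x y * |φ x - φ y| ≤
      Λ ^ 2 * (|u x - u y| ^ (p - 1) * |φ x - φ y| * ‖x - y‖ ^ (-((n : ℝ) + s * p))) := by
    calc _ ≤ Λ * |u x - u y| ^ (p - 1) * (Λ * ‖x - y‖ ^ (-((n : ℝ) + s * p))) * |φ x - φ y| := by
          gcongr
      _ = _ := by ring
  rw [← ENNReal.ofReal_add (by positivity) (by positivity), ← ENNReal.ofReal_mul (by positivity)]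
  rcases lt_trichotomy (u x) (u y) with h | h | h
  · rcases le_or_gt (φ y) (φ x) with h' | h'
    · have h3 := hΦ.le_neg_of_neg (by linarith : u x - u y < 0)
      have h8 : 0 ≤ (-(u x - u y)) ^ (p - 1) / Λ :=
        div_nonneg (Real.rpow_nonneg (by linarith) _) (by linarith)
      rw [ENNReal.ofReal_of_nonpos]
      · exact zero_le
      · have := mul_nonneg (mul_nonneg (h8.trans h3) hk0) (by linarith : 0 ≤ φ x - φ y)
        linarith
    · refine ENNReal.ofReal_le_ofReal ?_
      rw [abs_of_neg (by linarith : u x - u y < 0), abs_of_neg (by linarith : φ x - φ y < 0),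
        neg_sub, neg_sub] at main
      rw [max_eq_left (by linarith : 0 ≤ u y - u x), max_eq_left (by linarith : 0 ≤ -φ x - -φ y),
        max_eq_right (by linarith : -φ y - -φ x ≤ 0), neg_sub_neg, mul_zero, zero_mul, add_zero]
      refine le_trans ?_ main
      have : -Φ (u x - u y) ≤ |Φ (u x - u y)| := neg_le_abs _
      calc _ = -Φ (u x - u y) * K x y * (φ y - φ x) := by ring
        _ ≤ _ := by
          have h9 : 0 ≤ φ y - φ x := by linarith
          gcongr
  · rw [h, sub_self, hΦ.2.1]
    simp
  · rcases le_or_gt (φ x) (φ y) with h' | h'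
    · have h3 := hΦ.le_of_pos (by linarith : 0 < u x - u y)
      have h8 : 0 ≤ (u x - u y) ^ (p - 1) / Λ :=
        div_nonneg (Real.rpow_nonneg (by linarith) _) (by linarith)
      rw [ENNReal.ofReal_of_nonpos]
      · exact zero_le
      · have := mul_nonneg (mul_nonneg (h8.trans h3) hk0) (by linarith : 0 ≤ φ y - φ x)
        linarith
    · refine ENNReal.ofReal_le_ofReal ?_
      rw [abs_of_pos (by linarith : 0 < u x - u y), abs_of_pos (by linarith : 0 < φ x - φ y)]
        at main
      rw [max_eq_left (by linarith : 0 ≤ u x - u y), max_eq_left (by linarith : 0 ≤ -φ y - -φ x),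
        max_eq_right (by linarith : -φ x - -φ y ≤ 0), neg_sub_neg, mul_zero, zero_mul, zero_add]
      refine le_trans ?_ main
      have h9 : 0 ≤ φ x - φ y := by linarith
      gcongr
      exact le_abs_self _

end FluxDensity

theorem lintegral_ofReal_neg_le {α : Type*} [MeasurableSpace α] {ν : Measure α} {f : α → ℝ}
    (hf : Integrable f ν) (h : 0 ≤ ∫ a, f a ∂ν) :
    ∫⁻ a, ENNReal.ofReal (-f a) ∂ν ≤ ∫⁻ a, ENNReal.ofReal (f a) ∂ν := by
  rw [integral_eq_lintegral_pos_part_sub_lintegral_neg_part hf, sub_nonneg] at h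
  exact (ENNReal.toReal_le_toReal hf.neg.lintegral_lt_top.ne hf.lintegral_lt_top.ne).1 h

theorem lintegral_prod_upFlux {n : ℕ} {s p : ℝ} {u φ : Rn n → ℝ} (hu : Measurable u)
    (hφ : Measurable φ) :
    ∫⁻ w : Rn n × Rn n, ENNReal.ofReal (max (u w.2 - u w.1) 0 ^ (p - 1) *
      max (φ w.1 - φ w.2) 0 * ‖w.1 - w.2‖ ^ (-((n : ℝ) + s * p))) = upFlux n s p u φ := by
  rw [Measure.volume_eq_prod, lintegral_prod _ (by fun_prop)]
  rfl

theorem lintegral_prod_upFlux_swap {n : ℕ} {s p : ℝ} {u φ : Rn n → ℝ} (hu : Measurable u)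
    (hφ : Measurable φ) :
    ∫⁻ w : Rn n × Rn n, ENNReal.ofReal (max (u w.1 - u w.2) 0 ^ (p - 1) *
      max (φ w.2 - φ w.1) 0 * ‖w.2 - w.1‖ ^ (-((n : ℝ) + s * p))) = upFlux n s p u φ := by
  have hm : Measurable fun w : Rn n × Rn n => ENNReal.ofReal (max (u w.2 - u w.1) 0 ^ (p - 1) *
      max (φ w.1 - φ w.2) 0 * ‖w.1 - w.2‖ ^ (-((n : ℝ) + s * p))) := by fun_prop
  rw [← lintegral_prod_upFlux hu hφ]
  exact (Measure.measurePreserving_swap (α := Rn n) (β := Rn n)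
    (μ := volume) (ν := volume)).lintegral_comp hm

theorem lintegral_form_le {n : ℕ} {Λ s p : ℝ} {Φ : ℝ → ℝ} {K : Rn n → Rn n → ℝ}
    {u φ : Rn n → ℝ} (hK : KernelBounds n Λ s p K) (hΦ : PhiBounds Λ p Φ) (hΛ : 1 ≤ Λ)
    (hu : Measurable u) (hφ : Measurable φ) :
    ∫⁻ w : Rn n × Rn n, ENNReal.ofReal (Φ (u w.1 - u w.2) * K w.1 w.2 * (φ w.1 - φ w.2)) ≤
      ENNReal.ofReal (Λ ^ 2) * (upFlux n s p u (fun x => -φ x) +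
        upFlux n s p u (fun x => -φ x)) := by
  have hφn : Measurable fun x => -φ x := hφ.neg
  refine (lintegral_mono fun w : Rn n × Rn n =>
    form_density_le (u := u) (φ := φ) hK hΦ hΛ w.1 w.2).trans_eq ?_
  rw [lintegral_const_mul _ (by fun_prop), lintegral_add_left (by fun_prop)]
  congr 2
  · exact lintegral_prod_upFlux hu hφn
  · exact lintegral_prod_upFlux_swap hu hφn

/-- Supersolutions satisfy the flux inequality for admissible bounded test functions. -/
theorem upFlux_le_of_test {n : ℕ} {Λ s p : ℝ} {Φ : ℝ → ℝ} {K : Rn n → Rn n → ℝ}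
    {u φ : Rn n → ℝ} (hn : 0 < n) (hs : 0 < s) (hs1 : s < 1) (hp : 1 < p) (hΛ : 1 ≤ Λ)
    (hK : KernelBounds n Λ s p K) (hΦ : PhiBounds Λ p Φ)
    (hu : Measurable u) (hE : gagliardo n s p univ u < ⊤) {x₀ : Rn n} {r : ℝ} (hr : 0 < r)
    (htest : ∀ ψ : Rn n → ℝ, IsTestFun n (ball x₀ (4 * r)) ψ → (∀ x, 0 ≤ ψ x) →
      0 ≤ nonlocalForm n Φ K u ψ)
    (hφm : Measurable φ) (hφ0 : ∀ x, 0 ≤ φ x) {B L : ℝ} (hφB : ∀ x, φ x ≤ B)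
    (hφs : ∀ x, 3 * r ≤ ‖x - x₀‖ → φ x = 0)
    (hL : ∀ x y, |φ x - φ y| ≤ L * (|u x - u y| + ‖x - y‖)) :
    upFlux n s p u φ ≤ ENNReal.ofReal (2 * Λ ^ 4) * upFlux n s p u (fun x => -φ x) := by
  have hp0 : 0 < p := by linarith
  have hKm : Measurable fun w : Rn n × Rn n => K w.1 w.2 := hK.1
  have hΦm : Measurable Φ := hΦ.1.measurable
  have hF := memLp_diffQuot_of_abs_sub_le hn hs hs1 hp hu hE hφm hφ0 hφB hφs hL
  have hFm := measurable_diffQuot (s := s) (p := p) hφm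
  set F := diffQuot n s p φ with hFdef
  set a : Rn n × Rn n → ℝ := fun w => Φ (u w.1 - u w.2) * K w.1 w.2 with ha
  set e := (n : ℝ) + s * p with he
  set G : Rn n × Rn n → ℝ := fun w => a w * ‖w.1 - w.2‖ ^ (e / p) with hGdef
  have hGm : Measurable G := by fun_prop
  have hPQ : ENNReal.HolderConjugate (ENNReal.ofReal p)
      (ENNReal.ofReal p / ENNReal.ofReal (p - 1)) := by
    rw [← ENNReal.ofReal_div_of_pos (by linarith)]
    exact (Real.HolderConjugate.conjExponent hp).ennrealOfReal
  have hG : MemLp G (ENNReal.ofReal p / ENNReal.ofReal (p - 1)) := by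
    have h1 := (memLp_diffQuot hp0 hu hE).norm_rpow_div (ENNReal.ofReal (p - 1))
    rw [ENNReal.toReal_ofReal (by linarith)] at h1
    refine h1.of_le_mul (c := Λ ^ 2) hGm.aestronglyMeasurable (.of_forall fun w => ?_)
    obtain ⟨x, y⟩ := w
    simp only [hGdef, ha, diffQuot, Real.norm_eq_abs, abs_mul]
    rcases eq_or_ne x y with rfl | hxy
    · simp [hΦ.2.1]
      positivity
    have hd : 0 < ‖x - y‖ := norm_pos_iff.2 (sub_ne_zero.2 hxy)
    have hk0 : 0 ≤ K x y := le_trans (by positivity) (hK.le' hxy)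
    have h4 := hK.le hxy
    have h5 := hΦ.abs_le hΛ (u x - u y)
    rw [abs_of_nonneg (Real.rpow_nonneg hd.le (e / p)), abs_of_nonneg hk0,
      abs_of_nonneg (Real.rpow_nonneg hd.le (-(e / p))),
      abs_of_nonneg (Real.rpow_nonneg (mul_nonneg (abs_nonneg _) (Real.rpow_nonneg hd.le _)) _),
      Real.mul_rpow (abs_nonneg _) (Real.rpow_nonneg hd.le _), ← Real.rpow_mul hd.le]
    calc _ ≤ Λ * |u x - u y| ^ (p - 1) * (Λ * ‖x - y‖ ^ (-e)) * ‖x - y‖ ^ (e / p) := by gcongr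
      _ = Λ ^ 2 * (|u x - u y| ^ (p - 1) * (‖x - y‖ ^ (-e) * ‖x - y‖ ^ (e / p))) := by ring
      _ = _ := by
        rw [← Real.rpow_add hd]
        congr 4
        field_simp
        ring
  have haFG : ∀ w z, G w * F (w - (z, z)) = a w * (φ (w.1 - z) - φ (w.2 - z)) := by
    rintro ⟨x, y⟩ z
    simp only [hGdef, hFdef, diffQuot, Prod.fst_sub, Prod.snd_sub, sub_sub_sub_cancel_right]
    rcases eq_or_ne x y with rfl | hxy
    · simp
    have hd : 0 < ‖x - y‖ := norm_pos_iff.2 (sub_ne_zero.2 hxy)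
    have h1 := (Real.rpow_pos_of_pos hd (e / p)).ne'
    rw [← he, Real.rpow_neg hd.le]
    generalize ‖x - y‖ ^ (e / p) = N at h1
    field_simp
  have hJ := integral_prod_nonneg_of_test ENNReal.ofReal_ne_top hr hFm hGm hF hG hφm hφ0 hφB hφs
    haFG (fun ψ hψ hψ0 => by
      refine (htest ψ hψ hψ0).trans_eq ?_
      rw [nonlocalForm]
      simp only [ha]
      simp_rw [mul_right_comm])
  have hint : Integrable fun w : Rn n × Rn n => a w * (φ w.1 - φ w.2) := by
    refine (hG.integrable_mul hF (p := ENNReal.ofReal p / ENNReal.ofReal (p - 1))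
      (q := ENNReal.ofReal p)).congr (.of_forall fun w => ?_)
    have := haFG w 0
    rwa [show w - ((0 : Rn n), (0 : Rn n)) = w from sub_zero w, sub_zero, sub_zero] at this
  have hφn : Measurable fun x => -φ x := hφm.neg
  calc upFlux n s p u φ ≤ ∫⁻ w : Rn n × Rn n, ENNReal.ofReal (Λ ^ 2) *
        ENNReal.ofReal (-(a w * (φ w.1 - φ w.2))) := by
        rw [← lintegral_prod_upFlux hu hφm]
        exact lintegral_mono fun w => upFlux_density_le hK hΦ hΛ hp w.1 w.2
    _ = ENNReal.ofReal (Λ ^ 2) * ∫⁻ w : Rn n × Rn n, ENNReal.ofReal (-(a w * (φ w.1 - φ w.2))) :=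
        lintegral_const_mul _ (by fun_prop)
    _ ≤ ENNReal.ofReal (Λ ^ 2) * ∫⁻ w : Rn n × Rn n, ENNReal.ofReal (a w * (φ w.1 - φ w.2)) := by
        exact mul_le_mul_right (lintegral_ofReal_neg_le hint hJ) _
    _ ≤ ENNReal.ofReal (Λ ^ 2) * (ENNReal.ofReal (Λ ^ 2) * (upFlux n s p u (fun x => -φ x) +
          upFlux n s p u (fun x => -φ x))) := by
        exact mul_le_mul_right (lintegral_form_le hK hΦ hΛ hu hφm) _
    _ = _ := by
        rw [← two_mul, ← mul_assoc, ← mul_assoc, ← ENNReal.ofReal_mul (by positivity),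
          ← ENNReal.ofReal_ofNat 2, ← ENNReal.ofReal_mul (by positivity)]
        congr 2
        ring

theorem nonlocalForm_congr_ae {n : ℕ} {Φ : ℝ → ℝ} {K : Rn n → Rn n → ℝ} {u v φ : Rn n → ℝ}
    (h : u =ᵐ[volume] v) : nonlocalForm n Φ K u φ = nonlocalForm n Φ K v φ := by
  refine integral_congr_ae ?_
  filter_upwards [h] with x hx
  refine integral_congr_ae ?_
  filter_upwards [h] with y hy
  rw [hx, hy]

theorem setLIntegral_gagliardo_congr_ae {n : ℕ} {a b : ℝ} {O : Set (Rn n)} {u v : Rn n → ℝ}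
    (h : u =ᵐ[volume] v) :
    ∫⁻ x in O, ∫⁻ y in O, ENNReal.ofReal (|u x - u y| ^ a / ‖x - y‖ ^ b) =
      ∫⁻ x in O, ∫⁻ y in O, ENNReal.ofReal (|v x - v y| ^ a / ‖x - y‖ ^ b) := by
  refine lintegral_congr_ae ?_
  filter_upwards [ae_restrict_of_ae h] with x hx
  refine lintegral_congr_ae ?_
  filter_upwards [ae_restrict_of_ae h] with y hy
  rw [hx, hy]

theorem tailFn_congr_ae {n : ℕ} {s p r : ℝ} {x₀ : Rn n} {u v : Rn n → ℝ}
    (h : u =ᵐ[volume] v) : tailFn n s p u x₀ r = tailFn n s p v x₀ r := by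
  have : ∫⁻ x in (ball x₀ r)ᶜ,
        ENNReal.ofReal (|u x| ^ (p - 1) / ‖x - x₀‖ ^ ((n : ℝ) + s * p)) =
      ∫⁻ x in (ball x₀ r)ᶜ,
        ENNReal.ofReal (|v x| ^ (p - 1) / ‖x - x₀‖ ^ ((n : ℝ) + s * p)) := by
    refine lintegral_congr_ae ?_
    filter_upwards [ae_restrict_of_ae h] with x hx
    rw [hx]
  rw [tailFn, tailFn, this]

theorem IsTestFun.mono {n : ℕ} {O O' : Set (Rn n)} {φ : Rn n → ℝ} (h : IsTestFun n O φ)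
    (hO : O ⊆ O') : IsTestFun n O' φ :=
  ⟨h.1, h.2.1, h.2.2.trans hO⟩

/-- A function that is a.e. nonnegative on a ball has a measurable representative that is
nonnegative everywhere on this ball. -/
theorem exists_measurable_nonneg_on_ball {n : ℕ} {u : Rn n → ℝ} (hu : AEMeasurable u)
    {x₀ : Rn n} {R : ℝ} (h : ∀ᵐ x : Rn n, x ∈ ball x₀ R → 0 ≤ u x) :
    ∃ v : Rn n → ℝ, Measurable v ∧ u =ᵐ[volume] v ∧ ∀ x ∈ ball x₀ R, 0 ≤ v x := by
  classical
  refine ⟨fun x => if x ∈ ball x₀ R then max (hu.mk u x) 0 else hu.mk u x,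
    Measurable.ite measurableSet_ball (hu.measurable_mk.max measurable_const) hu.measurable_mk,
    ?_, fun x hx => ?_⟩
  · filter_upwards [hu.ae_eq_mk, h] with x hx h'
    split_ifs with hb
    · rw [← hx, max_eq_left (h' hb)]
    · exact hx
  · simp only [if_pos hx]
    exact le_max_right _ _

section Scaling

variable {n : ℕ} {x₀ : Rn n} {r : ℝ}

theorem lintegral_eq_lintegral_comp_affine (hr : 0 < r) {f : Rn n → ℝ≥0∞} (hf : Measurable f) :
    ∫⁻ x, f x = ENNReal.ofReal (r ^ n) * ∫⁻ x, f (x₀ + r • x) := by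
  have h1 : ∫⁻ x, f x = ∫⁻ x, f (x₀ + x) := (lintegral_add_left_eq_self f x₀).symm
  have h2 : ∫⁻ x, f (x₀ + r • x) = ∫⁻ x, f (x₀ + x) ∂(Measure.map (r • ·) volume) := by
    rw [lintegral_map (by fun_prop) (measurable_const_smul r)]
  rw [h1, h2, Measure.map_addHaar_smul _ hr.ne', lintegral_smul_measure, smul_eq_mul, ← mul_assoc,
    ← ENNReal.ofReal_mul (by positivity), abs_of_nonneg (by positivity)]
  have h3 : r ^ n * (r ^ Module.finrank ℝ (Rn n))⁻¹ = 1 := by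
    rw [finrank_euclideanSpace_fin]
    exact mul_inv_cancel₀ (by positivity)
  rw [h3, ENNReal.ofReal_one, one_mul]

theorem affine_mem_ball_iff (hr : 0 < r) {R : ℝ} {x : Rn n} :
    x₀ + r • x ∈ ball x₀ (R * r) ↔ x ∈ ball 0 R := by
  rw [mem_ball, mem_ball, dist_eq_norm, add_sub_cancel_left, norm_smul, Real.norm_of_nonneg hr.le,
    dist_zero_right, mul_comm, mul_lt_mul_iff_left₀ hr]

theorem setLIntegral_ball_eq_comp_affine (hr : 0 < r) {R : ℝ} {f : Rn n → ℝ≥0∞}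
    (hf : Measurable f) :
    ∫⁻ x in ball x₀ (R * r), f x = ENNReal.ofReal (r ^ n) * ∫⁻ x in ball 0 R, f (x₀ + r • x) := by
  rw [← lintegral_indicator measurableSet_ball, ← lintegral_indicator measurableSet_ball,
    lintegral_eq_lintegral_comp_affine (x₀ := x₀) hr (hf.indicator measurableSet_ball)]
  congr 1
  refine lintegral_congr fun x => ?_
  by_cases hx : x ∈ ball 0 R
  · rw [indicator_of_mem hx, indicator_of_mem ((affine_mem_ball_iff hr).2 hx)]
  · rw [indicator_of_notMem hx, indicator_of_notMem fun h => hx ((affine_mem_ball_iff hr).1 h)]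

theorem setLIntegral_compl_ball_eq_comp_affine (hr : 0 < r) {R : ℝ} {f : Rn n → ℝ≥0∞}
    (hf : Measurable f) :
    ∫⁻ x in (ball x₀ (R * r))ᶜ, f x =
      ENNReal.ofReal (r ^ n) * ∫⁻ x in (ball 0 R)ᶜ, f (x₀ + r • x) := by
  rw [← lintegral_indicator measurableSet_ball.compl,
    ← lintegral_indicator measurableSet_ball.compl,
    lintegral_eq_lintegral_comp_affine (x₀ := x₀) hr (hf.indicator measurableSet_ball.compl)]
  congr 1
  refine lintegral_congr fun x => ?_
  by_cases hx : x ∈ (ball 0 R)ᶜ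
  · rw [indicator_of_mem hx, indicator_of_mem]
    exact fun h => hx ((affine_mem_ball_iff hr).1 h)
  · rw [indicator_of_notMem hx, indicator_of_notMem]
    exact fun h => hx fun hb => h ((affine_mem_ball_iff hr).2 hb)

/-- The rescaling `x ↦ u (x₀ + r x) / d`. -/
def rescale (x₀ : Rn n) (r d : ℝ) (u : Rn n → ℝ) (x : Rn n) : ℝ := u (x₀ + r • x) / d

theorem measurable_rescale {d : ℝ} {u : Rn n → ℝ} (hu : Measurable u) :
    Measurable (rescale x₀ r d u) := by
  unfold rescale; fun_prop

theorem norm_affine_sub (hr : 0 < r) (x y : Rn n) :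
    ‖(x₀ + r • x) - (x₀ + r • y)‖ = r * ‖x - y‖ := by
  rw [add_sub_add_left_eq_sub, ← smul_sub, norm_smul, Real.norm_of_nonneg hr.le]

theorem upFlux_eq_rescale {s p d : ℝ} (hr : 0 < r) (hd : 0 < d) {u φ : Rn n → ℝ}
    (hu : Measurable u) (hφ : Measurable φ) :
    upFlux n s p u φ = ENNReal.ofReal (r ^ n * (r ^ n * (d ^ (p - 1) *
      r ^ (-((n : ℝ) + s * p))))) * upFlux n s p (rescale x₀ r d u) (fun x => φ (x₀ + r • x)) := by
  have hv : Measurable (rescale x₀ r d u) := measurable_rescale hu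
  have hm : Measurable fun w : Rn n × Rn n => ENNReal.ofReal (max (u w.2 - u w.1) 0 ^ (p - 1) *
      max (φ w.1 - φ w.2) 0 * ‖w.1 - w.2‖ ^ (-((n : ℝ) + s * p))) := by fun_prop
  have hm' : Measurable fun w : Rn n × Rn n =>
      ENNReal.ofReal (max (rescale x₀ r d u w.2 - rescale x₀ r d u w.1) 0 ^ (p - 1) *
      max (φ (x₀ + r • w.1) - φ (x₀ + r • w.2)) 0 * ‖w.1 - w.2‖ ^ (-((n : ℝ) + s * p))) := by
    fun_prop
  have h0 : 0 ≤ d ^ (p - 1) * r ^ (-((n : ℝ) + s * p)) := by positivity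
  rw [upFlux, lintegral_eq_lintegral_comp_affine (x₀ := x₀) hr hm.lintegral_prod_right',
    ENNReal.ofReal_mul (by positivity), mul_assoc, ENNReal.ofReal_mul (by positivity), mul_assoc,
    upFlux]
  congr 1
  rw [← lintegral_const_mul _ hm'.lintegral_prod_right', ← lintegral_const_mul _
    (hm'.lintegral_prod_right'.const_mul _)]
  refine lintegral_congr fun x => ?_
  dsimp only
  rw [lintegral_eq_lintegral_comp_affine (x₀ := x₀) hr (by fun_prop)]
  congr 1
  rw [← lintegral_const_mul _ (by fun_prop)]
  refine lintegral_congr fun y => ?_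
  rw [← ENNReal.ofReal_mul h0]
  congr 1
  simp only [rescale]
  rw [norm_affine_sub hr, Real.mul_rpow hr.le (norm_nonneg _)]
  have h1 : max (u (x₀ + r • y) - u (x₀ + r • x)) 0 =
      d * max (u (x₀ + r • y) / d - u (x₀ + r • x) / d) 0 := by
    rw [mul_max_of_nonneg _ _ hd.le, mul_zero, mul_sub, mul_div_cancel₀ _ hd.ne',
      mul_div_cancel₀ _ hd.ne']
  rw [h1, Real.mul_rpow hd.le (le_max_right _ _)]
  ring

theorem lintegral_tail_eq_rescale {s p d : ℝ} (hr : 0 < r) (hd : 0 < d) {u : Rn n → ℝ}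
    (hu : Measurable u) :
    ∫⁻ x in (ball x₀ (4 * r))ᶜ,
        ENNReal.ofReal (|max (-u x) 0| ^ (p - 1) / ‖x - x₀‖ ^ ((n : ℝ) + s * p)) =
      ENNReal.ofReal (r ^ n * (d ^ (p - 1) * r ^ (-((n : ℝ) + s * p)))) *
        negTail n s p (rescale x₀ r d u) := by
  have hv : Measurable (rescale x₀ r d u) := measurable_rescale hu
  have h0 : 0 ≤ d ^ (p - 1) * r ^ (-((n : ℝ) + s * p)) := by positivity
  rw [setLIntegral_compl_ball_eq_comp_affine hr (by fun_prop), ENNReal.ofReal_mul (by positivity),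
    mul_assoc, negTail]
  congr 1
  rw [← lintegral_const_mul _ (by fun_prop)]
  refine lintegral_congr fun x => ?_
  rw [← ENNReal.ofReal_mul h0]
  congr 1
  have h1 : max (-u (x₀ + r • x)) 0 = d * max (-rescale x₀ r d u x) 0 := by
    rw [mul_max_of_nonneg _ _ hd.le, mul_zero, rescale, mul_neg, mul_div_cancel₀ _ hd.ne']
  rw [abs_of_nonneg (le_max_right _ _), h1, Real.mul_rpow hd.le (le_max_right _ _),
    add_sub_cancel_left, norm_smul, Real.norm_of_nonneg hr.le, div_eq_mul_inv,
    ← Real.rpow_neg (by positivity), Real.mul_rpow hr.le (norm_nonneg _)]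
  ring

theorem gagliardo_ball_eq_rescale {q b d : ℝ} (hr : 0 < r) (hd : 0 < d) {u : Rn n → ℝ}
    (hu : Measurable u) :
    ∫⁻ x in ball x₀ (2 * r), ∫⁻ y in ball x₀ (2 * r),
        ENNReal.ofReal (|u x - u y| ^ q / ‖x - y‖ ^ b) =
      ENNReal.ofReal (r ^ n * (r ^ n * (d ^ q * r ^ (-b)))) *
        ∫⁻ x in ball 0 2, ∫⁻ y in ball 0 2,
          ENNReal.ofReal (|rescale x₀ r d u x - rescale x₀ r d u y| ^ q / ‖x - y‖ ^ b) := by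
  have hv : Measurable (rescale x₀ r d u) := measurable_rescale hu
  have hm : Measurable fun w : Rn n × Rn n =>
      ENNReal.ofReal (|u w.1 - u w.2| ^ q / ‖w.1 - w.2‖ ^ b) := by fun_prop
  have hm' : Measurable fun w : Rn n × Rn n =>
      ENNReal.ofReal (|rescale x₀ r d u w.1 - rescale x₀ r d u w.2| ^ q / ‖w.1 - w.2‖ ^ b) := by
    fun_prop
  have h0 : 0 ≤ d ^ q * r ^ (-b) := by positivity
  rw [setLIntegral_ball_eq_comp_affine hr hm.lintegral_prod_right',
    ENNReal.ofReal_mul (by positivity), mul_assoc, ENNReal.ofReal_mul (by positivity), mul_assoc]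
  congr 1
  rw [← lintegral_const_mul _ hm'.lintegral_prod_right', ← lintegral_const_mul _
    (hm'.lintegral_prod_right'.const_mul _)]
  refine lintegral_congr fun x => ?_
  dsimp only
  rw [setLIntegral_ball_eq_comp_affine hr (by fun_prop)]
  congr 1
  rw [← lintegral_const_mul _ (by fun_prop)]
  refine lintegral_congr fun y => ?_
  rw [← ENNReal.ofReal_mul h0]
  congr 1
  simp only [rescale]
  rw [norm_affine_sub hr, Real.mul_rpow hr.le (norm_nonneg _), ← sub_div, abs_div, abs_of_pos hd,
    Real.div_rpow (abs_nonneg _) hd.le, Real.rpow_neg hr.le]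
  have := (Real.rpow_pos_of_pos hd q).ne'
  field_simp

theorem ae_le_of_ae_one_le_rescale {d : ℝ} (hr : 0 < r) (hd : 0 < d) {u : Rn n → ℝ}
    (hu : Measurable u) (h : ∀ᵐ x ∂volume.restrict (ball (0 : Rn n) 1), 1 ≤ rescale x₀ r d u x) :
    ∀ᵐ x ∂volume.restrict (ball x₀ r), d ≤ u x := by
  have hS : MeasurableSet {x | u x < d} := measurableSet_lt hu measurable_const
  have h1 := setLIntegral_ball_eq_comp_affine (x₀ := x₀) (R := 1) hr
    (measurable_const.indicator hS : Measurable ({x | u x < d}.indicator fun _ => (1 : ℝ≥0∞)))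
  have h2 : ∫⁻ x in ball (0 : Rn n) 1,
      ({x | u x < d}.indicator fun _ => (1 : ℝ≥0∞)) (x₀ + r • x) = 0 := by
    rw [lintegral_eq_zero_iff (by fun_prop)]
    filter_upwards [h] with x hx
    refine indicator_of_notMem ?_ _
    rw [rescale, le_div_iff₀ hd, one_mul] at hx
    simpa using hx
  rw [h2, mul_zero, one_mul, lintegral_indicator_const hS, one_mul] at h1
  rw [ae_iff]
  simpa using h1

end Scaling

theorem fluxIneq_rescale {n : ℕ} {Λ s p : ℝ} {Φ : ℝ → ℝ} {K : Rn n → Rn n → ℝ} {u : Rn n → ℝ}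
    (hn : 0 < n) (hs : 0 < s) (hs1 : s < 1) (hp : 1 < p) (hΛ : 1 ≤ Λ)
    (hK : KernelBounds n Λ s p K) (hΦ : PhiBounds Λ p Φ) (hu : Measurable u)
    (hE : gagliardo n s p univ u < ⊤) {x₀ : Rn n} {r d : ℝ} (hr : 0 < r) (hd : 0 < d)
    (htest : ∀ ψ, IsTestFun n (ball x₀ (4 * r)) ψ → (∀ x, 0 ≤ ψ x) →
      0 ≤ nonlocalForm n Φ K u ψ) :
    FluxIneq n s p (ENNReal.ofReal (2 * Λ ^ 4)) (rescale x₀ r d u) := by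
  rintro φ hφm hφ0 ⟨B, hB⟩ hφs ⟨L, hL⟩
  set φ' : Rn n → ℝ := fun y => φ (r⁻¹ • (y - x₀)) with hφ'
  have hφ'm : Measurable φ' := by fun_prop
  have hcomp : ∀ x, φ' (x₀ + r • x) = φ x := fun x => by
    simp only [hφ', add_sub_cancel_left, inv_smul_smul₀ hr.ne']
  have key := upFlux_le_of_test (φ := φ') hn hs hs1 hp hΛ hK hΦ hu hE hr htest hφ'm
    (fun x => hφ0 _) (B := B) (L := |L| * (1 / d + 1 / r)) (fun x => hB _) (fun x hx => ?_)
    (fun x y => ?_)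
  · rw [upFlux_eq_rescale (x₀ := x₀) hr hd hu hφ'm,
      upFlux_eq_rescale (φ := fun x => -φ' x) (x₀ := x₀) hr hd hu hφ'm.neg,
      mul_left_comm (ENNReal.ofReal (2 * Λ ^ 4))] at key
    simp only [hcomp] at key
    refine (ENNReal.mul_le_mul_iff_right ?_ ENNReal.ofReal_ne_top).1 key
    exact (ENNReal.ofReal_pos.2 (by positivity)).ne'
  · refine hφs _ ?_
    rw [norm_smul, Real.norm_of_nonneg (by positivity), inv_mul_eq_div, le_div_iff₀ hr]
    exact hx
  · refine (hL _ _).trans ?_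
    have e1 : ∀ z, rescale x₀ r d u (r⁻¹ • (z - x₀)) = u z / d := fun z => by
      rw [rescale, smul_inv_smul₀ hr.ne', add_sub_cancel]
    rw [e1, e1, ← sub_div, abs_div, abs_of_pos hd, ← smul_sub, sub_sub_sub_cancel_right, norm_smul,
      Real.norm_of_nonneg (by positivity), mul_assoc]
    have h1 := abs_nonneg (u x - u y)
    have h2 := norm_nonneg (x - y)
    have h3 : (0 : ℝ) ≤ |u x - u y| / r := by positivity
    have h4 : (0 : ℝ) ≤ ‖x - y‖ / d := by positivity
    have h5 : |u x - u y| / d + r⁻¹ * ‖x - y‖ ≤ (1 / d + 1 / r) * (|u x - u y| + ‖x - y‖) := by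
      have : (1 / d + 1 / r) * (|u x - u y| + ‖x - y‖) =
          |u x - u y| / d + r⁻¹ * ‖x - y‖ + (|u x - u y| / r + ‖x - y‖ / d) := by ring
      linarith
    exact mul_le_mul (le_abs_self L) h5 (by positivity) (abs_nonneg L)

theorem negTail_rescale_le_one {n : ℕ} {s p d r : ℝ} {x₀ : Rn n} {u : Rn n → ℝ} (hs : 0 < s)
    (hp : 1 < p) (hr : 0 < r) (hd : 0 < d) (hu : Measurable u)
    (h : tailFn n s p (fun x => max (-u x) 0) x₀ (4 * r) ≤ ENNReal.ofReal d) :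
    negTail n s p (rescale x₀ r d u) ≤ 1 := by
  have hp1 : 0 < p - 1 := by linarith
  rw [tailFn, lintegral_tail_eq_rescale hr hd hu, one_div, ENNReal.rpow_inv_le_iff hp1,
    ENNReal.ofReal_rpow_of_pos hd, ← mul_assoc, ← ENNReal.ofReal_mul (by positivity)] at h
  have h4 : (1 : ℝ) ≤ 4 ^ (s * p) := Real.one_le_rpow (by norm_num) (by positivity)
  have e : (4 * r) ^ (s * p) * (r ^ n * (d ^ (p - 1) * r ^ (-((n : ℝ) + s * p)))) =
      4 ^ (s * p) * d ^ (p - 1) := by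
    rw [Real.mul_rpow (by norm_num) hr.le, Real.rpow_neg hr.le, Real.rpow_add hr,
      Real.rpow_natCast]
    have := (Real.rpow_pos_of_pos hr (s * p)).ne'
    field_simp
  have hd' : 0 < d ^ (p - 1) := Real.rpow_pos_of_pos hd _
  have h2 : ENNReal.ofReal (d ^ (p - 1)) * negTail n s p (rescale x₀ r d u) ≤
      ENNReal.ofReal (d ^ (p - 1)) * 1 := by
    rw [mul_one]
    refine le_trans (mul_le_mul_left (ENNReal.ofReal_le_ofReal ?_) _) h
    rw [e]
    nlinarith
  exact (ENNReal.mul_le_mul_iff_right (ENNReal.ofReal_pos.2 hd').ne' ENNReal.ofReal_ne_top).1 h2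

/-- The gradient bound for a level `d` that exceeds both the infimum and the tail. -/
theorem average_gagliardo_le_of_rescale {n : ℕ} {q h r d : ℝ} {x₀ : Rn n} {u : Rn n → ℝ}
    {M : ℝ≥0∞} (hq : 0 < q) (hr : 0 < r) (hd : 0 < d) (hu : Measurable u)
    (hM : ∫⁻ x in ball 0 2, ∫⁻ y in ball 0 2, ENNReal.ofReal
      (|rescale x₀ r d u x - rescale x₀ r d u y| ^ q / ‖x - y‖ ^ ((n : ℝ) + h * q)) ≤ M) :
    ((volume (ball x₀ (2 * r)))⁻¹ * ∫⁻ x in ball x₀ (2 * r), ∫⁻ y in ball x₀ (2 * r),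
      ENNReal.ofReal (|u x - u y| ^ q / ‖x - y‖ ^ ((n : ℝ) + h * q))) ^ (1 / q) ≤
      ((volume (ball (0 : Rn n) 2))⁻¹ * M) ^ (1 / q) * ENNReal.ofReal (d / r ^ h) := by
  have hv : volume (ball x₀ (2 * r)) = ENNReal.ofReal (r ^ n) * volume (ball (0 : Rn n) 2) := by
    have := setLIntegral_ball_eq_comp_affine (x₀ := x₀) (R := 2) hr
      (measurable_const : Measurable fun _ : Rn n => (1 : ℝ≥0∞))
    simpa using this
  have hrn : ENNReal.ofReal (r ^ n) ≠ 0 := (ENNReal.ofReal_pos.2 (by positivity)).ne'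
  have e : ENNReal.ofReal (d / r ^ h) =
      (ENNReal.ofReal (r ^ n * (d ^ q * r ^ (-((n : ℝ) + h * q))))) ^ (1 / q) := by
    rw [ENNReal.ofReal_rpow_of_pos (by positivity)]
    congr 1
    have : r ^ n * (d ^ q * r ^ (-((n : ℝ) + h * q))) = (d / r ^ h) ^ q := by
      rw [Real.div_rpow hd.le (by positivity), ← Real.rpow_mul hr.le, Real.rpow_neg hr.le,
        Real.rpow_add hr, Real.rpow_natCast]
      have := (Real.rpow_pos_of_pos hr (h * q)).ne'
      field_simp
    rw [this, one_div, Real.rpow_rpow_inv (by positivity) hq.ne']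
  rw [e, ← ENNReal.mul_rpow_of_nonneg _ _ (by positivity)]
  refine ENNReal.rpow_le_rpow ?_ (by positivity)
  rw [gagliardo_ball_eq_rescale hr hd hu, hv, ENNReal.mul_inv (Or.inl hrn)
    (Or.inl ENNReal.ofReal_ne_top), ENNReal.ofReal_mul (by positivity)]
  revert hM
  generalize ∫⁻ x in ball 0 2, ∫⁻ y in ball 0 2, ENNReal.ofReal
      (|rescale x₀ r d u x - rescale x₀ r d u y| ^ q / ‖x - y‖ ^ ((n : ℝ) + h * q)) = G
  intro hM
  calc (ENNReal.ofReal (r ^ n))⁻¹ * (volume (ball (0 : Rn n) 2))⁻¹ *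
        (ENNReal.ofReal (r ^ n) * ENNReal.ofReal (r ^ n * (d ^ q * r ^ (-((n : ℝ) + h * q)))) * G)
      = ((ENNReal.ofReal (r ^ n))⁻¹ * ENNReal.ofReal (r ^ n)) *
        ((volume (ball (0 : Rn n) 2))⁻¹ *
          ENNReal.ofReal (r ^ n * (d ^ q * r ^ (-((n : ℝ) + h * q)))) * G) := by ring
    _ ≤ 1 * ((volume (ball (0 : Rn n) 2))⁻¹ *
          ENNReal.ofReal (r ^ n * (d ^ q * r ^ (-((n : ℝ) + h * q)))) * M) := by
        rw [ENNReal.inv_mul_cancel hrn ENNReal.ofReal_ne_top]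
        exact mul_le_mul_right (mul_le_mul_right hM _) _
    _ = _ := by ring

/-- The gradient bound for supersolutions, with a constant depending on `h` and `q`. -/
theorem exists_average_gagliardo_le {n : ℕ} {s p Λ h q : ℝ} (hn : 2 ≤ n) (hs : 0 < s) (hs1 : s < 1)
    (hp : 1 < p) (hsp : s * p < n) (hΛ : 1 ≤ Λ) (hhs : h < s) (hq : 0 < q)
    (hqb : q < qBar n s p) :
    ∃ C : ℝ, 0 < C ∧ ∀ (Φ : ℝ → ℝ) (K : Rn n → Rn n → ℝ) (u : Rn n → ℝ) (x₀ : Rn n) (r : ℝ),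
      KernelBounds n Λ s p K → PhiBounds Λ p Φ → AEMeasurable u → gagliardo n s p univ u < ⊤ →
      0 < r → (∀ᵐ x : Rn n, x ∈ ball x₀ (4 * r) → 0 ≤ u x) →
      (∀ ψ, IsTestFun n (ball x₀ (4 * r)) ψ → (∀ x, 0 ≤ ψ x) → 0 ≤ nonlocalForm n Φ K u ψ) →
      ((volume (ball x₀ (2 * r)))⁻¹ * ∫⁻ x in ball x₀ (2 * r), ∫⁻ y in ball x₀ (2 * r),
        ENNReal.ofReal (|u x - u y| ^ q / ‖x - y‖ ^ ((n : ℝ) + h * q))) ^ (1 / q) ≤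
        ENNReal.ofReal (C / r ^ h) *
          (essInf (fun x => ENNReal.ofReal (u x)) (volume.restrict (ball x₀ r)) +
            tailFn n s p (fun x => max (-u x) 0) x₀ (4 * r)) := by
  obtain ⟨M, hM, hbound⟩ := exists_gagliardo_le (C := ENNReal.ofReal (2 * Λ ^ 4)) hn hs hs1 hp hsp
    hhs hq hqb ENNReal.ofReal_ne_top
  have hV : volume (ball (0 : Rn n) 2) ≠ 0 := (measure_ball_pos _ _ (by norm_num)).ne'
  set A : ℝ≥0∞ := ((volume (ball (0 : Rn n) 2))⁻¹ * M) ^ (1 / q) with hA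
  have hAtop : A ≠ ⊤ := ENNReal.rpow_ne_top_of_nonneg (by positivity)
    (ENNReal.mul_ne_top (ENNReal.inv_ne_top.2 hV) hM)
  refine ⟨A.toReal + 1, by positivity, fun Φ K w x₀ r hK hΦ hw hE hr hw0 htest => ?_⟩
  obtain ⟨u, hu, hwu, hu0⟩ := exists_measurable_nonneg_on_ball hw hw0
  have hEu : gagliardo n s p univ u < ⊤ := by
    rw [gagliardo] at hE ⊢
    rwa [setLIntegral_gagliardo_congr_ae hwu] at hE
  have hinf : essInf (fun x => ENNReal.ofReal (w x)) (volume.restrict (ball x₀ r)) =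
      essInf (fun x => ENNReal.ofReal (u x)) (volume.restrict (ball x₀ r)) := by
    refine essInf_congr_ae ?_
    filter_upwards [ae_restrict_of_ae hwu] with x hx
    rw [hx]
  have htail : tailFn n s p (fun x => max (-w x) 0) x₀ (4 * r) =
      tailFn n s p (fun x => max (-u x) 0) x₀ (4 * r) := by
    refine tailFn_congr_ae ?_
    filter_upwards [hwu] with x hx
    rw [hx]
  have htest' : ∀ ψ, IsTestFun n (ball x₀ (4 * r)) ψ → (∀ x, 0 ≤ ψ x) →
      0 ≤ nonlocalForm n Φ K u ψ := fun ψ h1 h2 => by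
    rw [← nonlocalForm_congr_ae hwu]
    exact htest ψ h1 h2
  rw [setLIntegral_gagliardo_congr_ae hwu, hinf, htail]
  have hc0 : ENNReal.ofReal ((A.toReal + 1) / r ^ h) ≠ 0 :=
    (ENNReal.ofReal_pos.2 (by positivity)).ne'
  rw [← ENNReal.div_le_iff' hc0 ENNReal.ofReal_ne_top]
  refine le_of_forall_gt_imp_ge_of_dense fun D hD => ?_
  rcases eq_or_ne D ⊤ with rfl | hDtop
  · exact le_top
  obtain ⟨d, hd, rfl⟩ : ∃ d : ℝ, 0 < d ∧ D = ENNReal.ofReal d :=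
    ⟨D.toReal, ENNReal.toReal_pos (bot_le.trans_lt hD).ne' hDtop,
      (ENNReal.ofReal_toReal hDtop).symm⟩
  rw [ENNReal.div_le_iff' hc0 ENNReal.ofReal_ne_top]
  have hnot : ¬∀ᵐ x ∂volume.restrict (ball (0 : Rn n) 1), 1 ≤ rescale x₀ r d u x := fun h1 => by
    refine (le_self_add.trans_lt hD).not_ge (le_essInf_of_ae_le _ ?_)
    filter_upwards [ae_le_of_ae_one_le_rescale hr hd hu h1] with x hx
    exact ENNReal.ofReal_le_ofReal hx
  have hM' := hbound (rescale x₀ r d u) (measurable_rescale hu)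
    (fluxIneq_rescale (by omega) hs hs1 hp hΛ hK hΦ hu hEu hr hd htest')
    (fun x hx => div_nonneg (hu0 _ ((affine_mem_ball_iff hr).2 (mem_ball_zero_iff.2 hx))) hd.le)
    (negTail_rescale_le_one hs hp hr hd hu (le_add_self.trans hD.le)) hnot
  refine (average_gagliardo_le_of_rescale hq hr hd hu hM').trans ?_
  rw [← ENNReal.ofReal_mul (by positivity), ← hA, ← ENNReal.ofReal_toReal hAtop,
    ← ENNReal.ofReal_mul ENNReal.toReal_nonneg]
  refine ENNReal.ofReal_le_ofReal ?_
  rw [ENNReal.toReal_ofReal ENNReal.toReal_nonneg, div_mul_eq_mul_div, mul_div_assoc']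
  gcongr
  linarith

/-- Lemma 7.3, fractional Caccioppoli-type bound for nonnegative
solutions. The constant `C (s - h) (q̄ - q)` depends only on `n, s, p, Λ, s - h, q̄ - q`. -/
theorem nonnegative_solution_gradient_bound
    (n : ℕ) (s p Λ : ℝ)
    (hn : 2 ≤ n) (hs : 0 < s) (hs1 : s < 1) (hp : 2 - s / (n : ℝ) < p)
    (hpn : p < (n : ℝ) / s) (hΛ : 1 ≤ Λ) :
    ∃ C : ℝ → ℝ → ℝ, (∀ a b : ℝ, 0 < a → 0 < b → 0 < C a b) ∧
      ∀ h q : ℝ, 0 < h → h < s → 0 < q → q < qBar n s p →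
        ∀ (Φ : ℝ → ℝ) (K : Rn n → Rn n → ℝ) (Ω : Set (Rn n)) (μ g u : Rn n → ℝ)
          (x₀ : Rn n) (r : ℝ),
          KernelBounds n Λ s p K → PhiBounds Λ p Φ → IsOpen Ω →
          ContDiff ℝ (⊤ : ℕ∞) μ → HasCompactSupport μ → (∀ x, 0 ≤ μ x) →
          memWsp n s p univ g →
          WeakSol n Φ K s p Ω μ g u →
          0 < r → ball x₀ (4 * r) ⊆ Ω →
          (∀ᵐ x : Rn n, x ∈ ball x₀ (4 * r) → 0 ≤ u x) →
          ((volume (ball x₀ (2 * r)))⁻¹ *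
              ∫⁻ x in ball x₀ (2 * r), ∫⁻ y in ball x₀ (2 * r),
                ENNReal.ofReal
                  (|u x - u y| ^ q / ‖x - y‖ ^ ((n : ℝ) + h * q))) ^ (1 / q) ≤
            ENNReal.ofReal (C (s - h) (qBar n s p - q) / r ^ h) *
              (essInf (fun x => ENNReal.ofReal (u x)) (volume.restrict (ball x₀ r)) +
                tailFn n s p (fun x => max (-u x) 0) x₀ (4 * r)) := by
  have hn0 : (2 : ℝ) ≤ n := by exact_mod_cast hn
  have hsn : s / (n : ℝ) < 1 := by rw [div_lt_one (by linarith)]; linarith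
  have hp1 : 1 < p := by linarith
  have hsp : s * p < n := by rwa [lt_div_iff₀ hs, mul_comm] at hpn
  have key : ∀ a b : ℝ, ∃ c : ℝ, 0 < c ∧ ∀ h q : ℝ, a = s - h → b = qBar n s p - q → h < s →
      0 < q → q < qBar n s p → ∀ (Φ : ℝ → ℝ) (K : Rn n → Rn n → ℝ) (u : Rn n → ℝ) (x₀ : Rn n)
        (r : ℝ), KernelBounds n Λ s p K → PhiBounds Λ p Φ → AEMeasurable u →
      gagliardo n s p univ u < ⊤ →
      0 < r → (∀ᵐ x : Rn n, x ∈ ball x₀ (4 * r) → 0 ≤ u x) →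
      (∀ ψ, IsTestFun n (ball x₀ (4 * r)) ψ → (∀ x, 0 ≤ ψ x) → 0 ≤ nonlocalForm n Φ K u ψ) →
      ((volume (ball x₀ (2 * r)))⁻¹ * ∫⁻ x in ball x₀ (2 * r), ∫⁻ y in ball x₀ (2 * r),
        ENNReal.ofReal (|u x - u y| ^ q / ‖x - y‖ ^ ((n : ℝ) + h * q))) ^ (1 / q) ≤
        ENNReal.ofReal (c / r ^ h) *
          (essInf (fun x => ENNReal.ofReal (u x)) (volume.restrict (ball x₀ r)) +
            tailFn n s p (fun x => max (-u x) 0) x₀ (4 * r)) := by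
    intro a b
    by_cases hab : s - a < s ∧ 0 < qBar n s p - b ∧ qBar n s p - b < qBar n s p
    · obtain ⟨c, hc, H⟩ := exists_average_gagliardo_le hn hs hs1 hp1 hsp hΛ hab.1 hab.2.1 hab.2.2
      refine ⟨c, hc, fun h q ha hb _ _ _ => ?_⟩
      obtain rfl : h = s - a := by linarith
      obtain rfl : q = qBar n s p - b := by linarith
      exact H
    · refine ⟨1, one_pos, fun h q ha hb h1 h2 h3 => absurd ⟨?_, ?_, ?_⟩ hab⟩ <;> linarith
  choose C hC H using key
  refine ⟨C, fun a b _ _ => hC a b, ?_⟩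
  intro h q _ hhs hq hqb Φ K Ω μ g u x₀ r hK hΦ _ _ _ hμ _ hu hr hball hu0
  have hum := hu.1.1
  rw [Measure.restrict_univ] at hum
  refine H _ _ h q rfl rfl hhs hq hqb Φ K u x₀ r hK hΦ hum hu.1.2.2 hr hu0 fun ψ hψ hψ0 => ?_
  rw [hu.2.2 ψ (hψ.mono hball)]
  exact integral_nonneg fun x => mul_nonneg (hψ0 x) (hμ x)
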